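/- arXiv:2411.07499 — 3 statements merged into one kernel-verified Lean document; each statement's English description precedes it below -/
import Mathlib

section
/- For every integer k ≥ 2 there exist constants C_k > 0 and c_k > 0 such that the following holds. Let G be a finite simple graph on n ≥ 2 vertices with m edges that contains no copy of C_{2k} and whose maximum degree satisfies Δ(G) ≤ m^(2/(k+1)), and let ≻ be a linear order on V(G) such that deg(u) > deg(v) implies u ≻ v. Then the number of capped k-walks in G is at most C_k·(log₂ n)^(c_k)·m^(2k/(k+1)). -/
open SimpleGraph

/-- The number of capped `k`-walks in `G` with respect to the strict order `r`. -/
noncomputable def cappedWalkCount {V : Type*} [Fintype V] (G : SimpleGraph V)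
    (r : V → V → Prop) (k : ℕ) : ℕ :=
  {x : Fin (k + 1) → V | (∀ i : Fin k, G.Adj (x i.castSucc) (x i.succ)) ∧
    ∀ i : Fin k, r (x 0) (x i.succ)}.ncard

theorem cycleGraph_isContained_of_injOn {V : Type*} {G : SimpleGraph V} {n : ℕ} (f : ℕ → V)
    (hinj : Set.InjOn f (Set.Iio n)) (hadj : ∀ t, t + 1 < n → G.Adj (f t) (f (t + 1)))
    (hlast : G.Adj (f (n - 1)) (f 0)) : cycleGraph n ⊑ G := by
  have key : ∀ u v : Fin n, ((u - v : Fin n) : ℕ) = 1 → G.Adj (f u) (f v) := by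
    intro u v h
    have hu := u.2
    have hv := v.2
    rw [Fin.val_sub] at h
    by_cases hvu : (v : ℕ) ≤ u
    · have h1 : n - v + u = (u - v) + n := by omega
      rw [h1, Nat.add_mod_right, Nat.mod_eq_of_lt (by omega)] at h
      have h2 : (u : ℕ) = v + 1 := by omega
      rw [h2]
      exact (hadj v (by omega)).symm
    · rw [Nat.mod_eq_of_lt (by omega)] at h
      have h1 : (u : ℕ) = 0 := by omega
      have h2 : (v : ℕ) = n - 1 := by omega
      rw [h1, h2]
      exact hlast.symm
  refine ⟨⟨⟨fun i => f i, ?_⟩, ?_⟩⟩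
  · intro a b hab
    rw [cycleGraph_adj'] at hab
    rcases hab with h | h
    · exact key a b h
    · exact (key b a h).symm
  · intro a b hab
    exact Fin.ext (hinj a.2 b.2 hab)

/-- In a bipartite graph of large minimum degree, a long path avoiding a small set can be
grown greedily from any vertex. -/
theorem exists_alternating_path {V : Type*} [DecidableEq V] (G : SimpleGraph V)
    [DecidableRel G.Adj] (X Y F : Finset V) (D : ℕ)
    (hX : ∀ x ∈ X, D ≤ (Y.filter (G.Adj x)).card) (hY : ∀ y ∈ Y, D ≤ (X.filter (G.Adj y)).card)
    (w : V) (hw : w ∈ Y) (hwF : w ∉ F) (n : ℕ) (hn : F.card + n < D + 1) :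
    ∃ h : ℕ → V, h 0 = w ∧ Set.InjOn h (Set.Iic n) ∧ (∀ t < n, G.Adj (h t) (h (t + 1))) ∧
      (∀ t ≤ n, (Even t → h t ∈ Y) ∧ (Odd t → h t ∈ X)) ∧ ∀ t ≤ n, h t ∉ F := by
  induction n with
  | zero =>
    refine ⟨fun _ => w, rfl, ?_, by simp, ?_, ?_⟩
    · intro a ha b hb _
      simp at ha hb
      omega
    · intro t ht
      have : t = 0 := by omega
      subst this
      simp [hw]
    · intro t _
      exact hwF
  | succ n ih =>
    obtain ⟨h, h0, hinj, hadj, hside, hF⟩ := ih (by omega)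
    have hstep : ∃ v, G.Adj (h n) v ∧ v ∉ F ∧ (∀ t ≤ n, h t ≠ v) ∧
        (Even (n + 1) → v ∈ Y) ∧ (Odd (n + 1) → v ∈ X) := by
      have haux : ∀ Z : Finset V, D ≤ (Z.filter (G.Adj (h n))).card →
          ∃ v ∈ Z, G.Adj (h n) v ∧ v ∉ F ∧ ∀ t ≤ n, h t ≠ v := by
        intro Z hZ
        have hc : (F ∪ (Finset.range n).image h).card < (Z.filter (G.Adj (h n))).card := by
          have h1 := Finset.card_union_le F ((Finset.range n).image h)
          have h2 := Finset.card_image_le (s := Finset.range n) (f := h)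
          rw [Finset.card_range] at h2
          omega
        obtain ⟨v, hv, hv'⟩ := Finset.exists_mem_notMem_of_card_lt_card hc
        simp only [Finset.mem_filter] at hv
        simp only [Finset.mem_union, Finset.mem_image, Finset.mem_range, not_or, not_exists,
          not_and] at hv'
        refine ⟨v, hv.1, hv.2, hv'.1, fun t ht => ?_⟩
        rcases Nat.lt_or_eq_of_le ht with ht | rfl
        · exact hv'.2 t ht
        · exact hv.2.ne
      rcases Nat.even_or_odd n with hn' | hn'
      · obtain ⟨v, hv, h1, h2, h3⟩ := haux X (hY _ ((hside n le_rfl).1 hn'))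
        exact ⟨v, h1, h2, h3, fun h => absurd h (by simpa [parity_simps] using hn'), fun _ => hv⟩
      · obtain ⟨v, hv, h1, h2, h3⟩ := haux Y (hX _ ((hside n le_rfl).2 hn'))
        exact ⟨v, h1, h2, h3, fun _ => hv, fun h => absurd h (by simpa [parity_simps] using hn')⟩
    obtain ⟨v, hv, hvF, hvne, hvY, hvX⟩ := hstep
    refine ⟨fun t => if t ≤ n then h t else v, by simp [h0], ?_, ?_, ?_, ?_⟩
    · intro a ha b hb hab
      simp only [Set.mem_Iic] at ha hb
      by_cases h1 : a ≤ n <;> by_cases h2 : b ≤ n <;> simp only [h1, h2, if_true, if_false] at hab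
      · exact hinj h1 h2 hab
      · exact absurd hab (hvne a h1)
      · exact absurd hab.symm (hvne b h2)
      · omega
    · intro t ht
      rcases Nat.lt_or_eq_of_le (Nat.lt_succ_iff.1 ht) with h1 | rfl
      · simpa [h1.le, Nat.succ_le_of_lt h1] using hadj t h1
      · simpa using hv
    · intro t ht
      by_cases h1 : t ≤ n
      · simpa [h1] using hside t h1
      · have : t = n + 1 := by omega
        subst this
        simpa using ⟨hvY, hvX⟩
    · intro t ht
      by_cases h1 : t ≤ n
      · simpa [h1] using hF t h1
      · simpa [h1] using hvF

theorem iterate_ne_of_iterate_ne {α : Type*} {f : α → α} {a b : α} {s t : ℕ} (hst : s ≤ t)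
    (h : f^[t] a ≠ f^[t] b) : f^[s] a ≠ f^[s] b := by
  intro hs
  apply h
  obtain ⟨d, rfl⟩ := Nat.exists_eq_add_of_le' hst
  rw [Function.iterate_add_apply, Function.iterate_add_apply, hs]

/-- Two consecutive levels of a rooted spanning tree that carry a subgraph of large minimum
degree force a cycle of length `2k`. -/
theorem cycleGraph_isContained_of_dense_levels {V : Type*} [DecidableEq V] (G : SimpleGraph V)
    [DecidableRel G.Adj] (lev : V → ℕ) (π : V → V) (r : V) (i k : ℕ) (hik : i < k)
    (hπ : ∀ v, 0 < lev v → G.Adj v (π v) ∧ lev (π v) + 1 = lev v) (X Y : Finset V)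
    (hlX : ∀ x ∈ X, lev x = i) (hlY : ∀ y ∈ Y, lev y = i + 1) (hr : ∀ x ∈ X, π^[i] x = r)
    (hX : ∀ x ∈ X, 2 * k + 3 ≤ (Y.filter (G.Adj x)).card)
    (hY : ∀ y ∈ Y, 2 * k + 3 ≤ (X.filter (G.Adj y)).card) (hne : Y.Nonempty) :
    cycleGraph (2 * k) ⊑ G := by
  -- the number of generations after which siblings have merged
  have hex : ∃ l, ∀ y ∈ Y, ∀ a ∈ X, ∀ b ∈ X, G.Adj y a → G.Adj y b → π^[l] a = π^[l] b :=
    ⟨i, fun y _ a ha b hb _ _ => by rw [hr a ha, hr b hb]⟩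
  classical
  set l := Nat.find hex with hl
  have hmerge := Nat.find_spec hex
  rw [← hl] at hmerge
  have hli : l ≤ i := Nat.find_min' hex fun y _ a ha b hb _ _ => by rw [hr a ha, hr b hb]
  have hl0 : l ≠ 0 := by
    intro h0
    rw [h0] at hmerge
    obtain ⟨y, hy⟩ := hne
    have h1 : 1 < (X.filter (G.Adj y)).card := by have := hY y hy; omega
    obtain ⟨a, ha, b, hb, hab⟩ := Finset.one_lt_card.1 h1
    simp only [Finset.mem_filter] at ha hb
    exact hab (hmerge y hy a ha.1 b hb.1 ha.2 hb.2)
  have hmin := Nat.find_min hex (m := l - 1) (by omega)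
  push Not at hmin
  obtain ⟨w, hw, u, hu, x, hx, hwu, hwx, hux⟩ := hmin
  have hlevY : ∀ y ∈ Y, ∀ x ∈ X, y ≠ x := by
    rintro y hy x hx rfl
    have := hlX _ hx
    have := hlY _ hy
    omega
  set p := k - l with hp
  obtain ⟨h, h0, hinj, hadj, hside, hF⟩ := exists_alternating_path G X Y {u, x} (2 * k + 3)
    hX hY w hw (by simp [hlevY w hw u hu, hlevY w hw x hx]) (2 * p - 1)
    (by have := Finset.card_le_two (a := u) (b := x); omega)
  set e := h (2 * p - 1) with he
  have heX : e ∈ X := (hside _ le_rfl).2 ⟨p - 1, by omega⟩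
  -- an endpoint in another branch than `e`
  obtain ⟨z, hzX, hwz, hzF, hze⟩ : ∃ z ∈ X, G.Adj w z ∧ (∀ t ≤ 2 * p - 1, h t ≠ z) ∧
      π^[l - 1] z ≠ π^[l - 1] e := by
    by_cases hue : π^[l - 1] u = π^[l - 1] e
    · refine ⟨x, hx, hwx, fun t ht hh => hF t ht (by simp [hh]), fun hh => hux (hue.trans hh.symm)⟩
    · exact ⟨u, hu, hwu, fun t ht hh => hF t ht (by simp [hh]), hue⟩
  have hconst : ∀ t, 2 * t + 1 ≤ 2 * p - 1 → π^[l] (h (2 * t + 1)) = π^[l] z := by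
    intro t
    induction t with
    | zero =>
      intro ht
      have h1 := hadj 0 (by omega)
      rw [h0] at h1
      exact hmerge w hw _ ((hside _ ht).2 (by simp)) z hzX h1 hwz
    | succ t ih =>
      intro ht
      rw [← ih (by omega)]
      have ha := hadj (2 * t + 2) (by omega)
      have hb := hadj (2 * t + 1) (by omega)
      exact hmerge (h (2 * t + 2)) ((hside _ (by omega)).1 ⟨t + 1, by ring⟩) _
        ((hside _ ht).2 ⟨t + 1, by ring⟩) _ ((hside _ (by omega)).2 ⟨t, by ring⟩) ha hb.symm
  have hez : π^[l] e = π^[l] z := by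
    have := hconst (p - 1) (by omega)
    rwa [show 2 * (p - 1) + 1 = 2 * p - 1 by omega] at this
  have hlev : ∀ s, s ≤ i → ∀ v ∈ X, lev (π^[s] v) = i - s := by
    intro s
    induction s with
    | zero => intro _ v hv; simpa using hlX v hv
    | succ s ih =>
      intro hs v hv
      have h1 := ih (by omega) v hv
      have h2 := (hπ (π^[s] v) (by omega)).2
      rw [Function.iterate_succ_apply']
      omega
  have hup : ∀ s, s < i → ∀ v ∈ X, G.Adj (π^[s] v) (π^[s + 1] v) := by
    intro s hs v hv
    rw [Function.iterate_succ_apply']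
    exact (hπ _ (by have := hlev s hs.le v hv; omega)).1
  have hlevh : ∀ t ≤ 2 * p - 1, i ≤ lev (h t) := by
    intro t ht
    rcases Nat.even_or_odd t with h1 | h1
    · have := hlY _ ((hside t ht).1 h1); omega
    · have := hlX _ ((hside t ht).2 h1); omega
  -- the cycle: `z`, then the path `h` ending in `e`, then up from `e` and down to `z`
  let f : ℕ → V := fun t => if t = 0 then z else if t ≤ 2 * p then h (t - 1) else
    if t ≤ 2 * p + l then π^[t - 2 * p] e else π^[2 * k - t] z
  have f0 : f 0 = z := by simp [f]
  have f1 : ∀ t, 0 < t → t ≤ 2 * p → f t = h (t - 1) := by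
    intro t h1 h2
    simp [f, h1.ne', h2]
  have f2 : ∀ t, 2 * p ≤ t → t ≤ 2 * p + l → f t = π^[t - 2 * p] e := by
    intro t h1 h2
    rcases Nat.lt_or_eq_of_le h1 with h3 | rfl
    · simp [f, show t ≠ 0 by omega, show ¬ t ≤ 2 * p by omega, h2]
    · rw [f1 _ (by omega) le_rfl]
      simp [he]
  have f3 : ∀ t, 2 * p + l ≤ t → t ≤ 2 * k → 0 < t → f t = π^[2 * k - t] z := by
    intro t h1 h2 h3
    rcases Nat.lt_or_eq_of_le h1 with h4 | rfl
    · simp [f, show t ≠ 0 by omega, show ¬ t ≤ 2 * p by omega, show ¬ t ≤ 2 * p + l by omega]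
    · rw [f2 _ (by omega) le_rfl, show 2 * p + l - 2 * p = l by omega,
        show 2 * k - (2 * p + l) = l by omega, hez]
  apply cycleGraph_isContained_of_injOn f
  · have main : ∀ a b, a < b → b < 2 * k → f a ≠ f b := by
      intro a b hab hb hfab
      have hlow : ∀ t, t ≤ 2 * p → i ≤ lev (f t) := by
        intro t ht
        rcases Nat.eq_zero_or_pos t with rfl | h1
        · rw [f0, hlX z hzX]
        · rw [f1 t h1 ht]
          exact hlevh _ (by omega)
      have hmid : ∀ t, 2 * p ≤ t → t ≤ 2 * p + l → lev (f t) = i - (t - 2 * p) := by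
        intro t h1 h2
        rw [f2 t h1 h2, hlev _ (by omega) e heX]
      have hhigh : ∀ t, 2 * p + l ≤ t → t < 2 * k → lev (f t) = i - (2 * k - t) := by
        intro t h1 h2
        rw [f3 t h1 h2.le (by omega), hlev _ (by omega) z hzX]
      have hlab : lev (f a) = lev (f b) := by rw [hfab]
      by_cases hb1 : b ≤ 2 * p
      · rcases Nat.eq_zero_or_pos a with rfl | ha
        · rw [f0, f1 b hab hb1] at hfab
          exact hzF _ (by omega) hfab.symm
        · rw [f1 a ha (by omega), f1 b (by omega) hb1] at hfab
          have := hinj (x₁ := a - 1) (x₂ := b - 1) (by simp; omega) (by simp; omega) hfab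
          omega
      · have hlb : lev (f b) < i := by
          by_cases hb2 : b ≤ 2 * p + l
          · rw [hmid b (by omega) hb2]; omega
          · rw [hhigh b (by omega) hb]; omega
        by_cases ha1 : a ≤ 2 * p
        · have := hlow a ha1
          omega
        · by_cases hb2 : b ≤ 2 * p + l
          · rw [hmid b (by omega) hb2, hmid a (by omega) (by omega)] at hlab
            omega
          · by_cases ha2 : a ≤ 2 * p + l
            · rw [hhigh b (by omega) hb, hmid a (by omega) ha2] at hlab
              have hs : a - 2 * p = 2 * k - b := by omega
              rw [f2 a (by omega) ha2, f3 b (by omega) hb.le (by omega), hs] at hfab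
              exact iterate_ne_of_iterate_ne (show 2 * k - b ≤ l - 1 by omega) hze hfab.symm
            · rw [hhigh b (by omega) hb, hhigh a (by omega) (by omega)] at hlab
              omega
    intro a ha b hb hab
    simp only [Set.mem_Iio] at ha hb
    by_contra hne
    rcases Nat.lt_or_gt_of_ne hne with h1 | h1
    · exact main a b h1 hb hab
    · exact main b a h1 ha hab.symm
  · intro t ht
    by_cases h1 : t + 1 ≤ 2 * p
    · rcases Nat.eq_zero_or_pos t with rfl | h2
      · rw [f0, f1 1 one_pos h1, show 1 - 1 = 0 from rfl, h0]
        exact hwz.symm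
      · rw [f1 t h2 (by omega), f1 (t + 1) (by omega) h1]
        have := hadj (t - 1) (by omega)
        rwa [show t - 1 + 1 = t + 1 - 1 by omega] at this
    · by_cases h2 : t + 1 ≤ 2 * p + l
      · rw [f2 t (by omega) (by omega), f2 (t + 1) (by omega) h2,
          show t + 1 - 2 * p = t - 2 * p + 1 by omega]
        exact hup _ (by omega) e heX
      · rw [f3 t (by omega) (by omega) (by omega), f3 (t + 1) (by omega) (by omega) (by omega),
          show 2 * k - t = 2 * k - (t + 1) + 1 by omega]
        exact (hup _ (by omega) z hzX).symm
  · rw [f0, f3 (2 * k - 1) (by omega) (by omega) (by omega),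
      show 2 * k - (2 * k - 1) = 0 + 1 by omega]
    exact (hup 0 (by omega) z hzX).symm

/-- A pair of sets spanning many edges contains a pair of nonempty subsets spanning a bipartite
graph of large minimum degree. -/
theorem exists_subset_minDegree {V : Type*} [DecidableEq V] (G : SimpleGraph V)
    [DecidableRel G.Adj] (A B : Finset V) (α β : ℝ) (hα : 0 ≤ α) (hβ : 0 ≤ β)
    (h : α * A.card + β * B.card < ∑ a ∈ A, ((B.filter (G.Adj a)).card : ℝ)) :
    ∃ A' ⊆ A, ∃ B' ⊆ B, A'.Nonempty ∧ B'.Nonempty ∧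
      (∀ a ∈ A', α ≤ (B'.filter (G.Adj a)).card) ∧
      ∀ b ∈ B', β ≤ (A'.filter (G.Adj b)).card := by
  have hswap : ∀ S T : Finset V, ∑ a ∈ S, ((T.filter (G.Adj a)).card : ℝ) =
      ∑ b ∈ T, ((S.filter (G.Adj b)).card : ℝ) := by
    intro S T
    have := Finset.sum_card_bipartiteAbove_eq_sum_card_bipartiteBelow (s := S) (t := T) G.Adj
    simp only [Finset.bipartiteAbove, Finset.bipartiteBelow] at this
    simp only [G.adj_comm] at this ⊢
    exact_mod_cast this
  let Φ : Finset V × Finset V → ℝ := fun P =>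
    ∑ a ∈ P.1, ((P.2.filter (G.Adj a)).card : ℝ) - α * P.1.card - β * P.2.card
  obtain ⟨⟨S, T⟩, hmem, hmax⟩ := Finset.exists_max_image (A.powerset ×ˢ B.powerset) Φ
    ⟨(A, B), by simp⟩
  simp only [Finset.mem_product, Finset.mem_powerset, Prod.forall] at hmem hmax
  have hpos : 0 < Φ (S, T) := lt_of_lt_of_le (by simp only [Φ]; linarith)
    (hmax A B ⟨subset_rfl, subset_rfl⟩)
  have hsum : (∑ a ∈ S, ((T.filter (G.Adj a)).card : ℝ)) ≠ 0 := by
    have h1 : 0 ≤ α * S.card := by positivity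
    have h2 : 0 ≤ β * T.card := by positivity
    simp only [Φ] at hpos
    intro h0
    linarith
  refine ⟨S, hmem.1, T, hmem.2, ?_, ?_, ?_, ?_⟩
  · rw [Finset.nonempty_iff_ne_empty]
    rintro rfl
    simp at hsum
  · rw [Finset.nonempty_iff_ne_empty]
    rintro rfl
    simp at hsum
  · intro a ha
    have h1 := hmax (S.erase a) T ⟨(Finset.erase_subset _ _).trans hmem.1, hmem.2⟩
    simp only [Φ] at h1
    rw [← Finset.add_sum_erase S _ ha, Finset.cast_card_erase_of_mem ha] at h1
    linarith
  · intro b hb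
    have h1 := hmax S (T.erase b) ⟨hmem.1, (Finset.erase_subset _ _).trans hmem.2⟩
    simp only [Φ] at h1
    rw [hswap S T, hswap S (T.erase b), ← Finset.add_sum_erase T _ hb,
      Finset.cast_card_erase_of_mem hb] at h1
    linarith

/-- In a bipartite graph without a cycle of length `2k`, the first `k` distance classes around
a vertex grow in proportion to the minimum degrees. -/
theorem prod_le_card_of_dist_eq {V : Type*} [Fintype V] [DecidableEq V] (G : SimpleGraph V)
    [DecidableRel G.Adj] (k : ℕ) (hfree : ¬ cycleGraph (2 * k) ⊑ G) (c : G.Coloring Bool) (r : V)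
    (δ : ℕ → ℝ) (hδ : ∀ i, 6 * (2 * k + 3) ≤ δ i)
    (hdeg : ∀ v, G.Reachable r v →
      δ (G.dist r v) ≤ (Finset.univ.filter (G.Adj v)).card) :
    ∃ L : Finset V, (∀ v ∈ L, ∃ p : G.Walk r v, p.length = k) ∧
      ∏ i ∈ Finset.range k, δ i ≤ (2 * (2 * k + 3)) ^ k * (L.card : ℝ) := by
  classical
  set D : ℝ := 2 * k + 3 with hD
  have hD0 : 0 < D := by positivity
  let L : ℕ → Finset V := fun i => Finset.univ.filter fun v => G.Reachable r v ∧ G.dist r v = i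
  have hL : ∀ i v, v ∈ L i ↔ G.Reachable r v ∧ G.dist r v = i := by simp [L]
  have hparent : ∀ v, ∃ u, 0 < G.dist r v → G.Adj v u ∧ G.dist r u + 1 = G.dist r v := by
    intro v
    by_cases hv : 0 < G.dist r v
    · obtain ⟨p, hp⟩ := (Reachable.of_dist_ne_zero hv.ne').symm.exists_walk_length_eq_dist
      rw [SimpleGraph.dist_comm] at hp
      cases p with
      | nil => simp at hv
      | @cons _ u _ hvu q =>
        refine ⟨u, fun _ => ⟨hvu, ?_⟩⟩
        have h1 : G.dist r u ≤ q.length := by rw [SimpleGraph.dist_comm]; exact dist_le q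
        have h2 : G.dist r v ≤ G.dist r u + 1 := by
          have := hvu.symm.diff_dist_adj (u := r)
          omega
        rw [Walk.length_cons] at hp
        omega
    · exact ⟨v, fun h => absurd h hv⟩
  choose π hπ using hparent
  have hroot : ∀ i, ∀ v ∈ L i, π^[i] v = r := by
    intro i
    induction i with
    | zero =>
      intro v hv
      rw [hL] at hv
      exact (hv.1.dist_eq_zero_iff.1 hv.2).symm
    | succ i ih =>
      intro v hv
      rw [hL] at hv
      rw [Function.iterate_succ_apply]
      have h1 := hπ v (by omega)
      exact ih _ ((hL _ _).2 ⟨hv.1.trans h1.1.reachable, by omega⟩)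
  have hnbr : ∀ v w, G.Reachable r v → G.Adj v w → G.dist r w ≠ G.dist r v := by
    intro v w hv hvw heq
    obtain ⟨p, hp⟩ := hv.exists_walk_length_eq_dist
    obtain ⟨q, hq⟩ := (hv.trans hvw.reachable).exists_walk_length_eq_dist
    have h1 := c.even_length_iff_congr p
    have h2 := c.even_length_iff_congr q
    have h3 := c.valid hvw
    rw [hp] at h1
    rw [hq, heq, h1] at h2
    revert h2 h3
    cases c r <;> cases c v <;> cases c w <;> simp
  -- consecutive levels span few edges
  have hsparse : ∀ i < k, ∑ a ∈ L i, (((L (i + 1)).filter (G.Adj a)).card : ℝ) ≤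
      D * (L i).card + D * (L (i + 1)).card := by
    intro i hik
    by_contra! hlt
    obtain ⟨X, hXL, Y, hYL, -, hYne, hX, hY⟩ :=
      exists_subset_minDegree G (L i) (L (i + 1)) D D hD0.le hD0.le hlt
    refine hfree (cycleGraph_isContained_of_dense_levels G (G.dist r) π r i k hik hπ X Y
      (fun x hx => ((hL _ _).1 (hXL hx)).2) (fun y hy => ((hL _ _).1 (hYL hy)).2)
      (fun x hx => hroot i x (hXL hx)) (fun x hx => ?_) (fun y hy => ?_) hYne)
    · have := hX x hx
      rw [hD] at this
      exact_mod_cast this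
    · have := hY y hy
      rw [hD] at this
      exact_mod_cast this
  have hsplit : ∀ i, ∀ v ∈ L (i + 1), (Finset.univ.filter (G.Adj v)).card ≤
      ((L i).filter (G.Adj v)).card + ((L (i + 2)).filter (G.Adj v)).card := by
    intro i v hv
    refine le_trans (Finset.card_le_card ?_) (Finset.card_union_le _ _)
    intro w hw
    rw [hL] at hv
    simp only [Finset.mem_filter, Finset.mem_univ, true_and] at hw
    simp only [Finset.mem_union, Finset.mem_filter, hL, hw, and_true]
    have h1 := hnbr v w hv.1 hw
    have h2 := hw.diff_dist_adj (u := r)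
    have h3 := hv.1.trans hw.reachable
    rcases h2 with h2 | h2 | h2
    · exact absurd h2 h1
    · exact Or.inr ⟨h3, by omega⟩
    · exact Or.inl ⟨h3, by omega⟩
  have hgrow : ∀ i < k, δ i * (L i).card ≤ 2 * D * (L (i + 1)).card := by
    intro i
    induction i with
    | zero =>
      intro hk
      have h0 : L 0 = {r} := by
        ext v
        rw [hL, Finset.mem_singleton]
        constructor
        · rintro ⟨h1, h2⟩
          exact (h1.dist_eq_zero_iff.1 h2).symm
        · rintro rfl
          exact ⟨Reachable.refl _, SimpleGraph.dist_self⟩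
      have h1 : (Finset.univ.filter (G.Adj r)).card ≤ (L 1).card := by
        refine Finset.card_le_card fun w hw => ?_
        simp only [Finset.mem_filter, Finset.mem_univ, true_and] at hw
        exact (hL _ _).2 ⟨hw.reachable, dist_eq_one_iff_adj.2 hw⟩
      have h2 := hdeg r (Reachable.refl _)
      rw [SimpleGraph.dist_self] at h2
      have h3 : ((Finset.univ.filter (G.Adj r)).card : ℝ) ≤ (L 1).card := by exact_mod_cast h1
      have h4 : (0 : ℝ) ≤ (L 1).card := by positivity
      have h5 : (0 : ℝ) ≤ (k : ℝ) := by positivity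
      rw [h0]
      simp only [Finset.card_singleton, Nat.cast_one, mul_one, zero_add]
      nlinarith
    | succ i ih =>
      intro hi
      have h1 := ih (by omega)
      have h2 : (L i).card ≤ ((L (i + 1)).card : ℝ) := by
        have := hδ i
        have h3 : (0 : ℝ) ≤ (L i).card := by positivity
        nlinarith
      have h3 : δ (i + 1) * (L (i + 1)).card ≤
          ∑ v ∈ L (i + 1), ((Finset.univ.filter (G.Adj v)).card : ℝ) := by
        rw [mul_comm, ← nsmul_eq_mul]
        refine Finset.card_nsmul_le_sum _ _ _ fun v hv => ?_
        rw [hL] at hv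
        have := hdeg v hv.1
        rwa [hv.2] at this
      have h4 : ∑ v ∈ L (i + 1), ((Finset.univ.filter (G.Adj v)).card : ℝ) ≤
          ∑ v ∈ L (i + 1), (((L i).filter (G.Adj v)).card : ℝ) +
          ∑ v ∈ L (i + 1), (((L (i + 2)).filter (G.Adj v)).card : ℝ) := by
        rw [← Finset.sum_add_distrib]
        refine Finset.sum_le_sum fun v hv => ?_
        exact_mod_cast hsplit i v hv
      have h5 : ∑ v ∈ L (i + 1), (((L i).filter (G.Adj v)).card : ℝ) =
          ∑ v ∈ L i, (((L (i + 1)).filter (G.Adj v)).card : ℝ) := by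
        have := Finset.sum_card_bipartiteAbove_eq_sum_card_bipartiteBelow
          (s := L (i + 1)) (t := L i) G.Adj
        simp only [Finset.bipartiteAbove, Finset.bipartiteBelow] at this
        simp only [G.adj_comm] at this ⊢
        exact_mod_cast this
      have h6 := hsparse i (by omega)
      have h7 := hsparse (i + 1) hi
      have h8 := hδ (i + 1)
      have h9 : (0 : ℝ) ≤ (L (i + 1)).card := by positivity
      nlinarith
  refine ⟨L k, fun v hv => ?_, ?_⟩
  · rw [hL] at hv
    obtain ⟨p, hp⟩ := hv.1.exists_walk_length_eq_dist
    exact ⟨p, hp.trans hv.2⟩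
  · have : ∀ i ≤ k, ∏ j ∈ Finset.range i, δ j ≤ (2 * D) ^ i * ((L i).card : ℝ) := by
      intro i
      induction i with
      | zero =>
        intro _
        have : 0 < (L 0).card :=
          Finset.card_pos.2 ⟨r, (hL _ _).2 ⟨Reachable.refl _, SimpleGraph.dist_self⟩⟩
        simpa using (by exact_mod_cast this : (1 : ℝ) ≤ (L 0).card)
      | succ i ih =>
        intro hi
        have hδ0 : 0 ≤ δ i := by linarith [hδ i]
        calc ∏ j ∈ Finset.range (i + 1), δ j = (∏ j ∈ Finset.range i, δ j) * δ i :=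
              Finset.prod_range_succ _ _
          _ ≤ (2 * D) ^ i * ((L i).card : ℝ) * δ i :=
              mul_le_mul_of_nonneg_right (ih (by omega)) hδ0
          _ = (2 * D) ^ i * (δ i * (L i).card) := by ring
          _ ≤ (2 * D) ^ i * (2 * D * (L (i + 1)).card) :=
              mul_le_mul_of_nonneg_left (hgrow i (by omega)) (by positivity)
          _ = (2 * D) ^ (i + 1) * ((L (i + 1)).card : ℝ) := by ring
    exact this k le_rfl

theorem prod_le_card_of_minDegree {V : Type*} [Fintype V] [DecidableEq V] (G : SimpleGraph V)
    [DecidableRel G.Adj] (k : ℕ) (hfree : ¬ cycleGraph (2 * k) ⊑ G) (A B : Finset V)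
    (hAB : Disjoint A B) (hne : A.Nonempty) (α β : ℝ)
    (hα : 6 * (2 * k + 3) ≤ α) (hβ : 6 * (2 * k + 3) ≤ β)
    (hA : ∀ a ∈ A, α ≤ (B.filter (G.Adj a)).card)
    (hB : ∀ b ∈ B, β ≤ (A.filter (G.Adj b)).card) :
    ∏ i ∈ Finset.range k, (if Even i then α else β) ≤
      (2 * (2 * k + 3)) ^ k * (((if Even k then A else B).card : ℕ) : ℝ) := by
  classical
  let H : SimpleGraph V :=
    { Adj := fun u v => G.Adj u v ∧ (u ∈ A ∧ v ∈ B ∨ u ∈ B ∧ v ∈ A)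
      symm := ⟨fun u v h => ⟨h.1.symm, by tauto⟩⟩
      loopless := ⟨fun v h => G.loopless.irrefl v h.1⟩ }
  have hHG : H ≤ G := fun u v h => h.1
  have hdis : ∀ v, v ∈ A → v ∉ B := fun v h1 h2 => Finset.disjoint_left.1 hAB h1 h2
  let c : H.Coloring Bool := Coloring.mk (fun v => decide (v ∈ A)) (by
    rintro u v ⟨-, h | h⟩
    · have := fun h' => hdis v h' h.2
      simpa [h.1] using this
    · have := fun h' => hdis u h' h.1
      simpa [h.2] using this)
  obtain ⟨r, hr⟩ := hne
  have hmem : ∀ v, H.Reachable r v → v ∈ A ∨ v ∈ B := by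
    rintro v ⟨p⟩
    cases hq : p.reverse with
    | nil => exact Or.inl hr
    | cons h q => exact h.2.imp And.left And.left
  have hside : ∀ v (p : H.Walk r v), if Even p.length then v ∈ A else v ∈ B := by
    intro v p
    have h1 := c.even_length_iff_congr p
    have h2 : (c r = true ↔ c v = true) ↔ v ∈ A := by
      change (decide (r ∈ A) = true ↔ decide (v ∈ A) = true) ↔ v ∈ A
      simp [hr]
    rw [h2] at h1
    split_ifs with h
    · exact h1.1 h
    · exact (hmem v ⟨p⟩).resolve_left fun h' => h (h1.2 h')
  obtain ⟨L, hL, hcard⟩ := prod_le_card_of_dist_eq H k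
    (fun h => hfree (h.trans (IsContained.of_le hHG))) c r
    (fun i => if Even i then α else β) (fun i => by split_ifs <;> assumption) (by
      intro v hv
      obtain ⟨p, hp⟩ := hv.exists_walk_length_eq_dist
      have h1 := hside v p
      rw [hp] at h1
      split_ifs at h1 ⊢ with h
      · refine (hA v h1).trans (Nat.cast_le.2 (Finset.card_le_card fun w hw => ?_))
        simp only [Finset.mem_filter] at hw
        simp only [Finset.mem_filter, Finset.mem_univ, true_and]
        exact ⟨hw.2, Or.inl ⟨h1, hw.1⟩⟩
      · refine (hB v h1).trans (Nat.cast_le.2 (Finset.card_le_card fun w hw => ?_))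
        simp only [Finset.mem_filter] at hw
        simp only [Finset.mem_filter, Finset.mem_univ, true_and]
        exact ⟨hw.2, Or.inr ⟨h1, hw.1⟩⟩)
  refine hcard.trans (mul_le_mul_of_nonneg_left (Nat.cast_le.2 (Finset.card_le_card ?_))
    (by positivity))
  intro v hv
  obtain ⟨p, hp⟩ := hL v hv
  have h1 := hside v p
  rw [hp] at h1
  split_ifs at h1 ⊢ <;> assumption

/-- The asymmetric Bondy–Simonovits theorem. -/
theorem asymmetric_bondy_simonovits {V : Type*} [Fintype V] [DecidableEq V] (G : SimpleGraph V)
    [DecidableRel G.Adj] (k : ℕ) (hk : k ≠ 0) (hfree : ¬ cycleGraph (2 * k) ⊑ G)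
    (A B : Finset V) (hAB : Disjoint A B) (e : ℝ)
    (he : e = ∑ a ∈ A, ((B.filter (G.Adj a)).card : ℝ))
    (hA : 24 * (2 * k + 3) * A.card ≤ e) (hB : 24 * (2 * k + 3) * B.card ≤ e) :
    e ^ (2 * k) ≤ (8 * (2 * k + 3)) ^ (2 * k) * (A.card * B.card : ℝ) ^ (k + 1) := by
  rcases (show 0 ≤ e by rw [he]; positivity).eq_or_lt with h0 | hpos
  · rw [← h0, zero_pow (by omega)]
    positivity
  have hA0 : 0 < (A.card : ℝ) := by
    rw [Nat.cast_pos, Finset.card_pos, Finset.nonempty_iff_ne_empty]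
    rintro rfl
    simp at he
    linarith
  have hB0 : 0 < (B.card : ℝ) := by
    rw [Nat.cast_pos, Finset.card_pos, Finset.nonempty_iff_ne_empty]
    rintro rfl
    simp at he
    linarith
  set α := e / (4 * A.card) with hα
  set β := e / (4 * B.card) with hβ
  have hα6 : 6 * (2 * k + 3) ≤ α := by rw [hα, le_div_iff₀ (by positivity)]; linarith
  have hβ6 : 6 * (2 * k + 3) ≤ β := by rw [hβ, le_div_iff₀ (by positivity)]; linarith
  obtain ⟨S, hSA, T, hTB, hS, hT, hSd, hTd⟩ := exists_subset_minDegree G A B α β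
    (by positivity) (by positivity) (by rw [← he, hα, hβ]; field_simp; linarith)
  have hST : Disjoint S T := Finset.disjoint_of_subset_left hSA
    (Finset.disjoint_of_subset_right hTB hAB)
  have h1 := prod_le_card_of_minDegree G k hfree S T hST hS α β hα6 hβ6 hSd hTd
  have h2 := prod_le_card_of_minDegree G k hfree T S hST.symm hT β α hβ6 hα6 hTd hSd
  have hcS : (S.card : ℝ) ≤ A.card := Nat.cast_le.2 (Finset.card_le_card hSA)
  have hcT : (T.card : ℝ) ≤ B.card := Nat.cast_le.2 (Finset.card_le_card hTB)
  have h3 : (α * β) ^ k ≤ (2 * (2 * k + 3)) ^ (2 * k) * (A.card * B.card : ℝ) := by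
    calc (α * β) ^ k = (∏ i ∈ Finset.range k, (if Even i then α else β)) *
          ∏ i ∈ Finset.range k, (if Even i then β else α) := by
          rw [← Finset.prod_mul_distrib, Finset.prod_congr rfl (g := fun _ => α * β)]
          · simp
          · intro i _
            split_ifs
            · rfl
            · exact mul_comm _ _
      _ ≤ ((2 * (2 * k + 3)) ^ k * (((if Even k then S else T).card : ℕ) : ℝ)) *
          ((2 * (2 * k + 3)) ^ k * (((if Even k then T else S).card : ℕ) : ℝ)) := by
          refine mul_le_mul h1 h2 (Finset.prod_nonneg fun i _ => ?_) (by positivity)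
          split_ifs <;> positivity
      _ = (2 * (2 * k + 3)) ^ (2 * k) * (S.card * T.card : ℝ) := by
          rw [two_mul k, pow_add]
          split_ifs <;> ring
      _ ≤ _ := by gcongr
  have h4 : e ^ (2 * k) = (α * β) ^ k * (16 * (A.card * B.card)) ^ k := by
    rw [← mul_pow, pow_mul]
    congr 1
    rw [hα, hβ]
    field_simp
    ring
  calc e ^ (2 * k) = (α * β) ^ k * (16 * (A.card * B.card)) ^ k := h4
    _ ≤ (2 * (2 * k + 3)) ^ (2 * k) * (A.card * B.card : ℝ) * (16 * (A.card * B.card)) ^ k := by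
        gcongr
    _ = _ := by
        rw [mul_pow 16, show (16 : ℝ) = 4 ^ 2 by norm_num, ← pow_mul,
          show (8 * (2 * k + 3) : ℝ) = 4 * (2 * (2 * k + 3)) by ring, mul_pow 4, pow_succ]
        ring

theorem sum_card_filter_adj_le_card_edgeFinset {V : Type*} [Fintype V] [DecidableEq V]
    (G : SimpleGraph V) [DecidableRel G.Adj] (A B : Finset V) (hAB : Disjoint A B) :
    ∑ a ∈ A, (B.filter (G.Adj a)).card ≤ G.edgeFinset.card := by
  have hdeg : ∀ (T : Finset V) (v : V), (T.filter (G.Adj v)).card ≤ G.degree v := by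
    intro T v
    rw [← card_neighborFinset_eq_degree]
    refine Finset.card_le_card fun w hw => ?_
    rw [mem_neighborFinset]
    exact (Finset.mem_filter.1 hw).2
  have h1 : ∑ a ∈ A, (B.filter (G.Adj a)).card ≤ ∑ a ∈ A, G.degree a :=
    Finset.sum_le_sum fun a _ => hdeg B a
  have h2 : ∑ a ∈ A, (B.filter (G.Adj a)).card ≤ ∑ b ∈ B, G.degree b := by
    have := Finset.sum_card_bipartiteAbove_eq_sum_card_bipartiteBelow (s := A) (t := B) G.Adj
    simp only [Finset.bipartiteAbove, Finset.bipartiteBelow] at this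
    simp only [G.adj_comm] at this ⊢
    rw [this]
    exact Finset.sum_le_sum fun b _ => hdeg A b
  have h3 : ∑ a ∈ A, G.degree a + ∑ b ∈ B, G.degree b ≤ ∑ v, G.degree v := by
    rw [← Finset.sum_union hAB]
    exact Finset.sum_le_sum_of_subset (Finset.subset_univ _)
  rw [sum_degrees_eq_twice_card_edges] at h3
  omega

theorem sum_card_filter_adj_le_of_disjoint {V : Type*} [Fintype V] [DecidableEq V]
    (G : SimpleGraph V) [DecidableRel G.Adj] (k : ℕ) (hk : k ≠ 0)
    (hfree : ¬ cycleGraph (2 * k) ⊑ G) (M : ℝ) (hM : 0 ≤ M) (hΔ : (G.maxDegree : ℝ) ≤ M ^ 2)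
    (hm : (G.edgeFinset.card : ℝ) ≤ M ^ (k + 1)) (A B : Finset V) (hAB : Disjoint A B) :
    ∑ a ∈ A, ((B.filter (G.Adj a)).card : ℝ) ≤
      8 * (2 * k + 3) * M * (√A.card * √B.card) := by
  obtain ⟨e, he⟩ : ∃ e : ℝ, e = ∑ a ∈ A, ((B.filter (G.Adj a)).card : ℝ) := ⟨_, rfl⟩
  rw [← he]
  have he0 : 0 ≤ e := by
    rw [he]
    exact Finset.sum_nonneg fun _ _ => Nat.cast_nonneg _
  have hdeg : ∀ S T : Finset V, ∑ a ∈ S, ((T.filter (G.Adj a)).card : ℝ) ≤ M ^ 2 * S.card := by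
    intro S T
    rw [mul_comm, ← nsmul_eq_mul]
    refine Finset.sum_le_card_nsmul _ _ _ fun a _ => le_trans ?_ hΔ
    refine Nat.cast_le.2 (le_trans ?_ (G.degree_le_maxDegree a))
    rw [← card_neighborFinset_eq_degree]
    refine Finset.card_le_card fun w hw => ?_
    rw [mem_neighborFinset]
    exact (Finset.mem_filter.1 hw).2
  have heA : e ≤ M ^ 2 * A.card := he.trans_le (hdeg A B)
  have heB : e ≤ M ^ 2 * B.card := by
    have := Finset.sum_card_bipartiteAbove_eq_sum_card_bipartiteBelow (s := A) (t := B) G.Adj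
    simp only [Finset.bipartiteAbove, Finset.bipartiteBelow] at this
    refine le_trans (le_of_eq ?_) (hdeg B A)
    rw [he, ← Nat.cast_sum, this, Nat.cast_sum]
    simp only [G.adj_comm]
  have hem : e ≤ M ^ (k + 1) := by
    refine le_trans ?_ hm
    rw [he]
    exact_mod_cast sum_card_filter_adj_le_card_edgeFinset G A B hAB
  set D : ℝ := 2 * k + 3 with hD
  have hD1 : 1 ≤ D := by have : (0 : ℝ) ≤ k := by positivity
                         linarith
  have ha0 : (0 : ℝ) ≤ A.card := by positivity
  have hb0 : (0 : ℝ) ≤ B.card := by positivity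
  have hsq : e ^ 2 ≤ (8 * D * M) ^ 2 * (A.card * B.card) := by
    have hcase : ∀ a b : ℝ, 0 ≤ a → 0 ≤ b → e ≤ 24 * D * a → e ≤ M ^ 2 * b →
        e ^ 2 ≤ (8 * D * M) ^ 2 * (a * b) := by
      intro a b h1 h2 h3 h4
      have h5 : e * e ≤ (24 * D * a) * (M ^ 2 * b) := mul_le_mul h3 h4 he0 (by positivity)
      have h6 : 0 ≤ (64 * D - 24) * (D * (M ^ 2 * (a * b))) :=
        mul_nonneg (by linarith) (by positivity)
      nlinarith
    by_cases hA : 24 * D * A.card ≤ e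
    · by_cases hB : 24 * D * B.card ≤ e
      · have h1 := asymmetric_bondy_simonovits G k hk hfree A B hAB e he hA hB
        rw [← hD] at h1
        rw [← pow_le_pow_iff_left₀ (by positivity) (by positivity) (Nat.succ_ne_zero k)]
        calc (e ^ 2) ^ (k + 1) = e ^ (2 * k) * e ^ 2 := by ring
          _ ≤ ((8 * D) ^ (2 * k) * (A.card * B.card : ℝ) ^ (k + 1)) * (M ^ (k + 1)) ^ 2 := by
              gcongr
          _ ≤ ((8 * D) ^ (2 * (k + 1)) * (A.card * B.card : ℝ) ^ (k + 1)) * (M ^ (k + 1)) ^ 2 := by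
              gcongr
              · linarith
              · omega
          _ = _ := by
              generalize 8 * D = E
              rw [Nat.succ_eq_add_one]
              ring
      · rw [mul_comm (A.card : ℝ)]
        exact hcase _ _ hb0 ha0 (le_of_not_ge hB) heA
    · exact hcase _ _ ha0 hb0 (le_of_not_ge hA) heB
  rw [← Real.sqrt_mul ha0]
  refine (pow_le_pow_iff_left₀ he0 (by positivity) two_ne_zero).1 ?_
  rw [mul_pow, Real.sq_sqrt (by positivity)]
  exact hsq

theorem sum_card_filter_adj_le {V : Type*} [Fintype V] [DecidableEq V]
    (G : SimpleGraph V) [DecidableRel G.Adj] (k : ℕ) (hk : k ≠ 0)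
    (hfree : ¬ cycleGraph (2 * k) ⊑ G) (M : ℝ) (hM : 0 ≤ M) (hΔ : (G.maxDegree : ℝ) ≤ M ^ 2)
    (hm : (G.edgeFinset.card : ℝ) ≤ M ^ (k + 1)) (A B : Finset V) :
    ∑ a ∈ A, ((B.filter (G.Adj a)).card : ℝ) ≤
      32 * (2 * k + 3) * M * (√A.card * √B.card) := by
  set R : ℝ := 8 * (2 * k + 3) * M * (√A.card * √B.card) with hR
  have hS : ∀ S : Finset V, ∑ a ∈ A, ∑ b ∈ B.filter (G.Adj a),
      (if a ∈ S ∧ b ∉ S then (1 : ℝ) else 0) ≤ R := by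
    intro S
    have h1 : ∑ a ∈ A, ∑ b ∈ B.filter (G.Adj a), (if a ∈ S ∧ b ∉ S then (1 : ℝ) else 0) =
        ∑ a ∈ A.filter (· ∈ S), (((B.filter (· ∉ S)).filter (G.Adj a)).card : ℝ) := by
      rw [Finset.sum_filter]
      refine Finset.sum_congr rfl fun a _ => ?_
      split_ifs with ha
      · simp only [ha, true_and]
        rw [Finset.sum_boole, Finset.filter_filter, Finset.filter_filter]
        simp only [and_comm]
      · simp [ha]
    rw [h1]
    refine (sum_card_filter_adj_le_of_disjoint G k hk hfree M hM hΔ hm _ _ ?_).trans ?_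
    · rw [Finset.disjoint_left]
      intro v hv hv'
      exact (Finset.mem_filter.1 hv').2 (Finset.mem_filter.1 hv).2
    · rw [hR]
      gcongr <;> exact Finset.filter_subset _ _
  have hcount : ∀ a b : V, a ≠ b →
      ∑ S : Finset V, (if a ∈ S ∧ b ∉ S then (1 : ℝ) else 0) =
        (Fintype.card (Finset V) : ℝ) / 4 := by
    intro a b hab
    have h1 : (Finset.univ.filter fun S : Finset V => a ∈ S ∧ b ∉ S) = Finset.Icc {a} {b}ᶜ := by
      ext S
      simp [Finset.subset_iff]
    have h2 : 2 ≤ Fintype.card V := by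
      have := Finset.card_le_univ {a, b}
      rwa [Finset.card_pair hab] at this
    rw [Finset.sum_boole, h1, Finset.card_Icc_finset (by simpa using hab.symm), Finset.card_compl,
      Finset.card_singleton, Finset.card_singleton, Fintype.card_finset, Nat.sub_sub]
    obtain ⟨d, hd⟩ := Nat.exists_eq_add_of_le' h2
    rw [hd, Nat.add_sub_cancel, pow_add]
    push_cast
    ring
  have hsum : ∑ S : Finset V, ∑ a ∈ A, ∑ b ∈ B.filter (G.Adj a),
      (if a ∈ S ∧ b ∉ S then (1 : ℝ) else 0) =
      (Fintype.card (Finset V) : ℝ) / 4 * ∑ a ∈ A, ((B.filter (G.Adj a)).card : ℝ) := by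
    rw [Finset.sum_comm, Finset.mul_sum]
    refine Finset.sum_congr rfl fun a _ => ?_
    rw [Finset.sum_comm, Finset.sum_congr rfl fun b hb =>
      hcount a b (Finset.mem_filter.1 hb).2.ne]
    rw [Finset.sum_const, nsmul_eq_mul, mul_comm]
  have hle := Finset.sum_le_card_nsmul (Finset.univ : Finset (Finset V)) _ R fun S _ => hS S
  rw [hsum, nsmul_eq_mul, Finset.card_univ] at hle
  have hpos : (0 : ℝ) < Fintype.card (Finset V) := by exact_mod_cast Fintype.card_pos
  have h4 : (∑ a ∈ A, ((B.filter (G.Adj a)).card : ℝ)) / 4 ≤ R := by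
    refine le_of_mul_le_mul_left ?_ hpos
    linarith
  linarith

theorem sum_sqrt_card_superlevel_le {V : Type*} [Fintype V] (f : V → ℕ) (N : ℕ)
    (hf : ∀ v, f v ≤ N) :
    ∑ s ∈ Finset.Icc 1 N, √((Finset.univ.filter fun v => s ≤ f v).card : ℝ) ≤
      √(1 + Real.log N) * √(∑ v, (f v : ℝ) ^ 2) := by
  calc ∑ s ∈ Finset.Icc 1 N, √((Finset.univ.filter fun v => s ≤ f v).card : ℝ)
      = ∑ s ∈ Finset.Icc 1 N, √((s : ℝ)⁻¹) *
          √((s : ℝ) * (Finset.univ.filter fun v => s ≤ f v).card) := by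
        refine Finset.sum_congr rfl fun s hs => ?_
        have : (0 : ℝ) < s := by exact_mod_cast (Finset.mem_Icc.1 hs).1
        rw [← Real.sqrt_mul (by positivity), inv_mul_cancel_left₀ this.ne']
    _ ≤ √(∑ s ∈ Finset.Icc 1 N, (s : ℝ)⁻¹) *
          √(∑ s ∈ Finset.Icc 1 N, (s : ℝ) * (Finset.univ.filter fun v => s ≤ f v).card) :=
        Real.sum_sqrt_mul_sqrt_le _ (fun _ => by positivity) fun _ => by positivity
    _ ≤ _ := by
        gcongr
        · have := harmonic_le_one_add_log N
          rw [harmonic_eq_sum_Icc] at this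
          push_cast at this
          exact this
        · have h1 : ∀ s : ℕ, (s : ℝ) * (Finset.univ.filter fun v => s ≤ f v).card =
              ∑ v, if s ≤ f v then (s : ℝ) else 0 := by
            intro s
            rw [← Finset.sum_filter, Finset.sum_const, nsmul_eq_mul, mul_comm]
          simp only [h1]
          rw [Finset.sum_comm]
          refine Finset.sum_le_sum fun v _ => ?_
          rw [← Finset.sum_filter]
          have h2 : (Finset.Icc 1 N).filter (fun s => s ≤ f v) = Finset.Icc 1 (f v) := by
            ext s
            have := hf v
            simp only [Finset.mem_filter, Finset.mem_Icc]
            omega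
          rw [h2]
          have h3 := Finset.sum_le_card_nsmul (Finset.Icc 1 (f v)) (fun s : ℕ => (s : ℝ)) (f v)
            fun s hs => Nat.cast_le.2 (Finset.mem_Icc.1 hs).2
          simpa [sq] using h3

/-- A bound for the number of edges between any two sets yields, up to a logarithm, a bound for
the bilinear form of the adjacency matrix. -/
theorem sum_mul_sum_adj_le {V : Type*} [Fintype V] [DecidableEq V] (G : SimpleGraph V)
    [DecidableRel G.Adj] (Q : ℝ) (hQ0 : 0 ≤ Q)
    (hQ : ∀ A B : Finset V, ∑ a ∈ A, ((B.filter (G.Adj a)).card : ℝ) ≤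
      Q * (√A.card * √B.card)) (f g : V → ℕ) (N : ℕ)
    (hf : ∀ v, f v ≤ N) (hg : ∀ v, g v ≤ N) :
    ∑ u, (f u : ℝ) * ∑ v ∈ Finset.univ.filter (G.Adj u), (g v : ℝ) ≤
      Q * (1 + Real.log N) * (√(∑ v, (f v : ℝ) ^ 2) * √(∑ v, (g v : ℝ) ^ 2)) := by
  have hlayer : ∀ h : V → ℕ, (∀ v, h v ≤ N) → ∀ v,
      (h v : ℝ) = ∑ s ∈ Finset.Icc 1 N, if s ≤ h v then (1 : ℝ) else 0 := by
    intro h hh v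
    rw [Finset.sum_boole]
    have h2 : (Finset.Icc 1 N).filter (fun s => s ≤ h v) = Finset.Icc 1 (h v) := by
      ext s
      have := hh v
      simp only [Finset.mem_filter, Finset.mem_Icc]
      omega
    rw [h2]
    simp
  let F : ℕ → Finset V := fun s => Finset.univ.filter fun v => s ≤ f v
  let E : ℕ → Finset V := fun t => Finset.univ.filter fun v => t ≤ g v
  have hlog : 0 ≤ 1 + Real.log N := by
    have := Real.log_natCast_nonneg N
    linarith
  calc ∑ u, (f u : ℝ) * ∑ v ∈ Finset.univ.filter (G.Adj u), (g v : ℝ)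
      = ∑ s ∈ Finset.Icc 1 N, ∑ t ∈ Finset.Icc 1 N,
          ∑ a ∈ F s, (((E t).filter (G.Adj a)).card : ℝ) := by
        have h1 : ∀ u, ∑ v ∈ Finset.univ.filter (G.Adj u), (g v : ℝ) =
            ∑ t ∈ Finset.Icc 1 N, (((E t).filter (G.Adj u)).card : ℝ) := by
          intro u
          rw [Finset.sum_congr rfl fun v _ => hlayer g hg v, Finset.sum_comm]
          refine Finset.sum_congr rfl fun t _ => ?_
          rw [Finset.sum_boole, Finset.filter_filter, Finset.filter_filter]
          simp only [and_comm]
        simp only [h1]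
        have h2 : ∀ (u : V) (c : ℝ), (f u : ℝ) * c =
            ∑ s ∈ Finset.Icc 1 N, if s ≤ f u then c else 0 := by
          intro u c
          rw [hlayer f hf u, Finset.sum_mul]
          simp
        simp only [h2]
        rw [Finset.sum_comm]
        refine Finset.sum_congr rfl fun s _ => ?_
        rw [← Finset.sum_filter, Finset.sum_comm]
    _ ≤ ∑ s ∈ Finset.Icc 1 N, ∑ t ∈ Finset.Icc 1 N, Q * (√(F s).card * √(E t).card) :=
        Finset.sum_le_sum fun s _ => Finset.sum_le_sum fun t _ => hQ _ _
    _ = Q * ((∑ s ∈ Finset.Icc 1 N, √((F s).card : ℝ)) *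
          ∑ t ∈ Finset.Icc 1 N, √((E t).card : ℝ)) := by
        rw [Finset.sum_mul_sum, Finset.mul_sum]
        simp only [Finset.mul_sum]
    _ ≤ Q * ((√(1 + Real.log N) * √(∑ v, (f v : ℝ) ^ 2)) *
          (√(1 + Real.log N) * √(∑ v, (g v : ℝ) ^ 2))) := by
        gcongr
        · exact sum_sqrt_card_superlevel_le f N hf
        · exact sum_sqrt_card_superlevel_le g N hg
    _ = Q * (√(1 + Real.log N) * √(1 + Real.log N)) *
          (√(∑ v, (f v : ℝ) ^ 2) * √(∑ v, (g v : ℝ) ^ 2)) := by ring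
    _ = _ := by rw [Real.mul_self_sqrt hlog]

/-- The sum of `f` over the endpoints of the `j`-step walks starting at a vertex. -/
def walkSum {V : Type*} [Fintype V] (G : SimpleGraph V) [DecidableRel G.Adj] (f : V → ℕ) :
    ℕ → V → ℕ
  | 0, u => f u
  | j + 1, u => ∑ v ∈ Finset.univ.filter (G.Adj u), walkSum G f j v

theorem walkSum_le {V : Type*} [Fintype V] (G : SimpleGraph V) [DecidableRel G.Adj] (f : V → ℕ)
    (hf : ∀ v, f v ≤ Fintype.card V) (j : ℕ) (u : V) :
    walkSum G f j u ≤ Fintype.card V ^ (j + 1) := by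
  induction j generalizing u with
  | zero => simpa [walkSum] using hf u
  | succ j ih =>
    rw [walkSum]
    refine (Finset.sum_le_card_nsmul _ _ _ fun v _ => ih v).trans ?_
    rw [smul_eq_mul, pow_succ' _ (j + 1)]
    exact Nat.mul_le_mul_right _ (Finset.card_le_univ _)

theorem sqrt_sum_walkSum_sq_le {V : Type*} [Fintype V] [DecidableEq V] (G : SimpleGraph V)
    [DecidableRel G.Adj] (Q : ℝ) (hQ0 : 0 ≤ Q)
    (hQ : ∀ A B : Finset V, ∑ a ∈ A, ((B.filter (G.Adj a)).card : ℝ) ≤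
      Q * (√A.card * √B.card)) (f : V → ℕ) (hf : ∀ v, f v ≤ Fintype.card V)
    (hV : 0 < Fintype.card V) (K j : ℕ) (hj : j ≤ K) :
    √(∑ v, (walkSum G f j v : ℝ) ^ 2) ≤
      (Q * (1 + Real.log ((Fintype.card V ^ (K + 1) : ℕ) : ℝ))) ^ j *
        √(∑ v, (f v : ℝ) ^ 2) := by
  set N : ℕ := Fintype.card V ^ (K + 1) with hN
  have hlog : 0 ≤ 1 + Real.log N := by
    have := Real.log_natCast_nonneg N
    linarith
  have hle : ∀ i ≤ K, ∀ v, walkSum G f i v ≤ N := fun i hi v =>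
    (walkSum_le G f hf i v).trans (Nat.pow_le_pow_right hV (by omega))
  induction j with
  | zero => simp [walkSum]
  | succ j ih =>
    have h1 := sum_mul_sum_adj_le G Q hQ0 hQ (walkSum G f (j + 1)) (walkSum G f j) N
      (hle _ hj) (hle _ (by omega))
    have h2 : ∑ u, (walkSum G f (j + 1) u : ℝ) *
        ∑ v ∈ Finset.univ.filter (G.Adj u), (walkSum G f j v : ℝ) =
        √(∑ v, (walkSum G f (j + 1) v : ℝ) ^ 2) * √(∑ v, (walkSum G f (j + 1) v : ℝ) ^ 2) := by
      rw [Real.mul_self_sqrt (by positivity)]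
      refine Finset.sum_congr rfl fun u _ => ?_
      rw [sq]
      congr 1
      simp [walkSum]
    rw [h2] at h1
    have h3 : √(∑ v, (walkSum G f (j + 1) v : ℝ) ^ 2) ≤
        Q * (1 + Real.log N) * √(∑ v, (walkSum G f j v : ℝ) ^ 2) := by
      rcases (Real.sqrt_nonneg (∑ v, (walkSum G f (j + 1) v : ℝ) ^ 2)).eq_or_lt with h0 | hpos
      · rw [← h0]
        positivity
      · refine le_of_mul_le_mul_left (h1.trans (le_of_eq ?_)) hpos
        ring
    calc _ ≤ Q * (1 + Real.log N) * √(∑ v, (walkSum G f j v : ℝ) ^ 2) := h3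
      _ ≤ Q * (1 + Real.log N) * ((Q * (1 + Real.log N)) ^ j * √(∑ v, (f v : ℝ) ^ 2)) := by
          gcongr
          exact ih (by omega)
      _ = _ := by ring

theorem sum_walks_eq_sum_walkSum {V : Type*} [Fintype V] [DecidableEq V] (G : SimpleGraph V)
    [DecidableRel G.Adj] (f g : V → ℕ) (j : ℕ) :
    ∑ x : Fin (j + 1) → V, (if ∀ i : Fin j, G.Adj (x i.castSucc) (x i.succ) then
      g (x 0) * f (x (Fin.last j)) else 0) = ∑ u, g u * walkSum G f j u := by
  induction j generalizing g with
  | zero =>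
    rw [← (Equiv.funUnique (Fin 1) V).symm.sum_comp]
    simp [walkSum]
  | succ j ih =>
    have h1 := ih (fun w => ∑ u ∈ Finset.univ.filter (G.Adj w), g u)
    have h2 : ∑ u, g u * walkSum G f (j + 1) u =
        ∑ w, (∑ u ∈ Finset.univ.filter (G.Adj w), g u) * walkSum G f j w := by
      simp only [walkSum, Finset.mul_sum, Finset.sum_mul, Finset.sum_filter]
      rw [Finset.sum_comm]
      refine Finset.sum_congr rfl fun w _ => Finset.sum_congr rfl fun u _ => ?_
      by_cases h : G.Adj u w
      · simp [h, h.symm]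
      · have h' : ¬ G.Adj w u := fun h' => h h'.symm
        simp [h, h']
    rw [h2, ← h1, ← (Fin.consEquiv fun _ : Fin (j + 2) => V).sum_comp, Fintype.sum_prod_type,
      Finset.sum_comm]
    refine Finset.sum_congr rfl fun x _ => ?_
    have h3 : ∀ u : V, (∀ i : Fin (j + 1), G.Adj
        ((Fin.cons u x : Fin (j + 2) → V) i.castSucc) ((Fin.cons u x : Fin (j + 2) → V) i.succ)) ↔
        G.Adj (x 0) u ∧ ∀ i : Fin j, G.Adj (x i.castSucc) (x i.succ) := by
      intro u
      rw [Fin.forall_fin_succ]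
      simp only [Fin.castSucc_zero, Fin.cons_zero, Fin.cons_succ, ← Fin.succ_castSucc]
      rw [G.adj_comm]
    simp only [Fin.consEquiv_apply, h3]
    simp only [← Fin.succ_last, Fin.cons_zero, Fin.cons_succ]
    by_cases h : ∀ i : Fin j, G.Adj (x i.castSucc) (x i.succ)
    · simp [h, Finset.sum_filter, Finset.sum_mul]
    · simp [h]

theorem cappedWalkCount_le {V : Type*} [Fintype V] [DecidableEq V] (G : SimpleGraph V)
    [DecidableRel G.Adj] (r : V → V → Prop) (hr : IsStrictTotalOrder V r)
    (hdeg : ∀ u v : V, G.degree u > G.degree v → r u v) (f : V → ℕ)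
    (hf : ∀ u v, G.degree v ≤ G.degree u → G.degree v ≤ f u * f v) (K : ℕ) :
    cappedWalkCount G r (K + 1) ≤ ∑ u, f u * walkSum G f K u := by
  classical
  rw [cappedWalkCount, Set.ncard_eq_toFinset_card', ← sum_walks_eq_sum_walkSum, ← Finset.sum_filter]
  set S := {x : Fin (K + 1 + 1) → V | (∀ i : Fin (K + 1), G.Adj (x i.castSucc) (x i.succ)) ∧
    ∀ i : Fin (K + 1), r (x 0) (x i.succ)}.toFinset with hS
  set T := Finset.univ.filter fun x : Fin (K + 1) → V =>
    ∀ i : Fin K, G.Adj (x i.castSucc) (x i.succ) with hT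
  have hmaps : ∀ x ∈ S, Fin.init x ∈ T := by
    intro x hx
    simp only [hS, Set.mem_toFinset, Set.mem_ofPred_eq] at hx
    simp only [hT, Finset.mem_filter, Finset.mem_univ, true_and, Fin.init]
    intro i
    exact hx.1 i.castSucc
  rw [Finset.card_eq_sum_card_fiberwise hmaps]
  refine Finset.sum_le_sum fun y _ => ?_
  rcases (S.filter fun x => Fin.init x = y).eq_empty_or_nonempty with h0 | ⟨z, hz⟩
  · rw [h0]
    simp
  · have hle : G.degree (y (Fin.last K)) ≤ G.degree (y 0) := by
      simp only [hS, Finset.mem_filter, Set.mem_toFinset, Set.mem_ofPred_eq] at hz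
      obtain ⟨⟨-, hz⟩, rfl⟩ := hz
      simp only [Fin.init, Fin.castSucc_zero]
      by_contra! hlt
      have h1 := hdeg _ _ hlt
      rcases Nat.eq_zero_or_pos K with rfl | hK
      · exact (lt_irrefl _ hlt)
      · have h2 := hz ⟨K - 1, by omega⟩
        have h3 : (Fin.succ ⟨K - 1, by omega⟩ : Fin (K + 1 + 1)) = (Fin.last K).castSucc := by
          ext
          simp
          omega
        rw [h3] at h2
        exact irrefl_of r _ (trans_of r h1 h2)
    refine le_trans ?_ (hf _ _ hle)
    rw [← card_neighborFinset_eq_degree]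
    refine Finset.card_le_card_of_injOn (fun x => x (Fin.last (K + 1))) ?_ ?_
    · intro x hx
      simp only [hS, Finset.coe_filter, Set.mem_toFinset, Set.mem_ofPred_eq] at hx
      obtain ⟨⟨hx, -⟩, rfl⟩ := hx
      simp only [Finset.mem_coe, mem_neighborFinset]
      exact hx (Fin.last K)
    · intro a ha b hb hab
      simp only [Finset.coe_filter, Set.mem_ofPred_eq] at ha hb
      rw [← Fin.snoc_init_self a, ← Fin.snoc_init_self b, ha.2, hb.2]
      simp only at hab
      rw [hab]

theorem exists_weight_of_degree {V : Type*} [Fintype V] (G : SimpleGraph V)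
    [DecidableRel G.Adj] :
    ∃ f : V → ℕ, (∀ v, f v ≤ Fintype.card V) ∧ (∀ v, f v ^ 2 ≤ 4 * G.degree v) ∧
      ∀ u v, G.degree v ≤ G.degree u → G.degree v ≤ f u * f v := by
  have hpos : ∀ v, G.degree v ≠ 0 → 1 ≤ Nat.sqrt (G.degree v) := fun v hv =>
    Nat.le_sqrt.2 (by omega)
  refine ⟨fun v => if G.degree v = 0 then 0 else Nat.sqrt (G.degree v) + 1, ?_, ?_, ?_⟩
  · intro v
    dsimp only
    split_ifs with h
    · exact Nat.zero_le _
    · have := G.degree_lt_card_verts v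
      have := Nat.sqrt_le_self (G.degree v)
      omega
  · intro v
    dsimp only
    split_ifs with h
    · simp
    · have := hpos v h
      have := Nat.sqrt_le (G.degree v)
      nlinarith
  · intro u v huv
    dsimp only
    split_ifs with h1 h2 h2
    · omega
    · omega
    · omega
    · have h3 := Nat.sqrt_le_sqrt huv
      have h4 := Nat.lt_succ_sqrt (G.degree v)
      rw [Nat.succ_eq_add_one] at h4
      nlinarith

theorem cappedWalkCount_le_mul_card_edgeFinset {V : Type*} [Fintype V] [DecidableEq V]
    (G : SimpleGraph V) [DecidableRel G.Adj] (r : V → V → Prop) (hr : IsStrictTotalOrder V r)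
    (hdeg : ∀ u v : V, G.degree u > G.degree v → r u v) (Q : ℝ) (hQ0 : 0 ≤ Q)
    (hQ : ∀ A B : Finset V, ∑ a ∈ A, ((B.filter (G.Adj a)).card : ℝ) ≤
      Q * (√A.card * √B.card)) (hV : 0 < Fintype.card V) (K : ℕ) :
    (cappedWalkCount G r (K + 1) : ℝ) ≤
      (Q * (1 + Real.log ((Fintype.card V ^ (K + 1) : ℕ) : ℝ))) ^ K *
        (8 * (G.edgeFinset.card : ℝ)) := by
  obtain ⟨f, hfV, hfsq, hf⟩ := exists_weight_of_degree G
  have h1 : (cappedWalkCount G r (K + 1) : ℝ) ≤ ∑ u, (f u : ℝ) * walkSum G f K u := by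
    exact_mod_cast cappedWalkCount_le G r hr hdeg f hf K
  have h2 := sqrt_sum_walkSum_sq_le G Q hQ0 hQ f hfV hV K K le_rfl
  have h3 : ∑ v, (f v : ℝ) ^ 2 ≤ 8 * (G.edgeFinset.card : ℝ) := by
    have h4 : ∑ v, f v ^ 2 ≤ 8 * G.edgeFinset.card := by
      calc ∑ v, f v ^ 2 ≤ ∑ v, 4 * G.degree v := Finset.sum_le_sum fun v _ => hfsq v
        _ = 8 * G.edgeFinset.card := by
          rw [← Finset.mul_sum, sum_degrees_eq_twice_card_edges]
          ring
    exact_mod_cast h4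
  have hκ0 : 0 ≤ Q * (1 + Real.log ((Fintype.card V ^ (K + 1) : ℕ) : ℝ)) :=
    mul_nonneg hQ0 (add_nonneg zero_le_one (Real.log_natCast_nonneg _))
  generalize Q * (1 + Real.log ((Fintype.card V ^ (K + 1) : ℕ) : ℝ)) = κ at h2 hκ0 ⊢
  calc (cappedWalkCount G r (K + 1) : ℝ) ≤ ∑ u, (f u : ℝ) * walkSum G f K u := h1
    _ ≤ √(∑ v, (f v : ℝ) ^ 2) * √(∑ v, (walkSum G f K v : ℝ) ^ 2) :=
      Real.sum_mul_le_sqrt_mul_sqrt _ _ _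
    _ ≤ √(∑ v, (f v : ℝ) ^ 2) * (κ ^ K * √(∑ v, (f v : ℝ) ^ 2)) :=
      mul_le_mul_of_nonneg_left h2 (Real.sqrt_nonneg _)
    _ = κ ^ K * ∑ v, (f v : ℝ) ^ 2 := by
      rw [mul_left_comm, Real.mul_self_sqrt (Finset.sum_nonneg fun _ _ => sq_nonneg _)]
    _ ≤ κ ^ K * (8 * (G.edgeFinset.card : ℝ)) :=
      mul_le_mul_of_nonneg_left h3 (pow_nonneg hκ0 K)

/-- DKS bound on capped `k`-walks: a `C_{2k}`-free graph with `Δ(G) ≤ m^(2/(k+1))`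
has at most `C_k·(log₂ n)^(c_k)·m^(2k/(k+1))` capped `k`-walks. -/
theorem capped_walks_bound (k : ℕ) (hk : 2 ≤ k) :
    ∃ C c : ℝ, 0 < C ∧ 0 < c ∧
      ∀ (V : Type) [Fintype V] [DecidableEq V] (G : SimpleGraph V) [DecidableRel G.Adj]
        (r : V → V → Prop), IsStrictTotalOrder V r →
        (∀ u v : V, G.degree u > G.degree v → r u v) →
        2 ≤ Fintype.card V →
        (¬ ∃ H : G.Subgraph, Nonempty (H.coe ≃g cycleGraph (2 * k))) →
        (G.maxDegree : ℝ) ≤ (G.edgeFinset.card : ℝ) ^ (2 / ((k : ℝ) + 1)) →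
        (cappedWalkCount G r k : ℝ) ≤
          C * (Real.logb 2 (Fintype.card V)) ^ c *
            (G.edgeFinset.card : ℝ) ^ (2 * (k : ℝ) / ((k : ℝ) + 1)) := by
  obtain ⟨K, rfl⟩ := Nat.exists_eq_add_of_le' (show 1 ≤ k by omega)
  have hK : 0 < K := by omega
  refine ⟨8 * (32 * (2 * (K + 1 : ℕ) + 3) * ((K + 1 : ℕ) + 1)) ^ K, K, by positivity,
    by exact_mod_cast hK, ?_⟩
  intro V _ _ G _ r hr hdeg hV hfree hΔ
  have hfree' : ¬ cycleGraph (2 * (K + 1)) ⊑ G := by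
    rw [isContained_iff_exists_iso_subgraph]
    rintro ⟨H, ⟨φ⟩⟩
    exact hfree ⟨H, ⟨φ.symm⟩⟩
  set m : ℝ := (G.edgeFinset.card : ℝ) with hm
  have hm0 : 0 ≤ m := Nat.cast_nonneg _
  set k' : ℝ := ((K + 1 : ℕ) : ℝ) with hk'
  have hk0 : 0 ≤ k' := Nat.cast_nonneg _
  set M : ℝ := m ^ (1 / (k' + 1)) with hM
  have hM0 : 0 ≤ M := Real.rpow_nonneg hm0 _
  have hMpow : ∀ j : ℕ, M ^ j = m ^ (j / (k' + 1)) := by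
    intro j
    rw [hM, ← Real.rpow_natCast, ← Real.rpow_mul hm0]
    congr 1
    ring
  have hM2 : M ^ 2 = m ^ (2 / (k' + 1)) := by
    rw [hMpow]
    norm_num
  have hMm : M ^ (K + 1 + 1) = m := by
    rw [hMpow, Nat.cast_succ, ← hk', div_self (by positivity), Real.rpow_one]
  have hMK : M ^ K * m = m ^ (2 * k' / (k' + 1)) := by
    conv_lhs => rw [← hMm]
    rw [← pow_add, hMpow]
    congr 2
    rw [hk']
    push_cast
    ring
  set Q : ℝ := 32 * (2 * k' + 3) * M with hQ
  have hQ0 : 0 ≤ Q := by positivity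
  have h1 := cappedWalkCount_le_mul_card_edgeFinset G r hr hdeg Q hQ0
    (sum_card_filter_adj_le G (K + 1) K.succ_ne_zero hfree' M hM0 (hΔ.trans_eq hM2.symm) hMm.ge)
    (by omega) K
  have hn : (2 : ℝ) ≤ Fintype.card V := by exact_mod_cast hV
  set L : ℝ := Real.logb 2 (Fintype.card V) with hL
  have hL1 : 1 ≤ L := by
    rw [hL, Real.le_logb_iff_rpow_le one_lt_two (by linarith), Real.rpow_one]
    exact hn
  have hlog : Real.log (Fintype.card V) ≤ L := by
    have h5 : 0 ≤ Real.log (Fintype.card V) := Real.log_nonneg (by linarith)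
    rw [hL, Real.logb, le_div_iff₀ (Real.log_pos one_lt_two)]
    have := Real.log_two_lt_d9
    nlinarith
  have hκ : Q * (1 + Real.log ((Fintype.card V ^ (K + 1) : ℕ) : ℝ)) ≤
      32 * (2 * k' + 3) * (k' + 1) * L * M := by
    rw [Nat.cast_pow, Real.log_pow, ← hk']
    have h6 : 1 + k' * Real.log (Fintype.card V) ≤ (k' + 1) * L := by nlinarith
    calc Q * (1 + k' * Real.log (Fintype.card V)) ≤ Q * ((k' + 1) * L) := by gcongr
      _ = _ := by rw [hQ]; ring
  have hκ0 : 0 ≤ Q * (1 + Real.log ((Fintype.card V ^ (K + 1) : ℕ) : ℝ)) :=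
    mul_nonneg hQ0 (add_nonneg zero_le_one (Real.log_natCast_nonneg _))
  have hκK := pow_le_pow_left₀ hκ0 hκ K
  calc (cappedWalkCount G r (K + 1) : ℝ) ≤ _ := h1
    _ ≤ (32 * (2 * k' + 3) * (k' + 1) * L * M) ^ K * (8 * m) :=
      mul_le_mul_of_nonneg_right hκK (by linarith)
    _ = 8 * (32 * (2 * k' + 3) * (k' + 1)) ^ K * L ^ K * (M ^ K * m) := by
      rw [mul_pow _ M, mul_pow _ L]
      ring
    _ = _ := by rw [hMK, Real.rpow_natCast]
end

section
/- There exists an absolute constant c > 0 such that the following holds. Let G be a finite simple bipartite graph with vertex bipartition A ⊔ B, with m edges and t copies of C_6. Let L = |A| and R = |B| with 100 ≤ L ≤ R, and set d_L = m/L, d_R = m/R, and n = 2^(⌈log₂(L+R)⌉). Suppose m/⌈log₂(L+R)⌉^10 > L + R + (L·R)^(2/3). Then t ≥ c · d_R³·d_L³ · min(1, d_R³/L, d_L²·d_R²/L²) / (log₂ n)^70. -/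
open SimpleGraph

/-- The number of subgraphs of `G` isomorphic to the cycle on `n` vertices. -/
noncomputable def countCopiesOfCycle (n : ℕ) {V : Type*} (G : SimpleGraph V) : ℕ :=
  {H : G.Subgraph | Nonempty (H.coe ≃g cycleGraph n)}.ncard

section Hexagons

variable {V : Type*} [Fintype V] [DecidableEq V] (G : SimpleGraph V) [DecidableRel G.Adj]

/-- The injective labelled closed walks of length six. -/
def labelledHexagons : Finset (Fin 6 → V) :=
  {f | Function.Injective f ∧ ∀ i, G.Adj (f i) (f (i + 1))}

/-- The labelled hexagon as a copy of the cycle graph. -/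
def hexagonCopy (f : Fin 6 → V) (hf : Function.Injective f)
    (hadj : ∀ i, G.Adj (f i) (f (i + 1))) : Copy (cycleGraph 6) G where
  toHom :=
    { toFun := f
      map_rel' := by
        intro a b hab
        rcases cycleGraph_adj.mp hab with h | h
        · have : a = b + 1 := by rw [← h]; abel
          rw [this]; exact (hadj b).symm
        · have : b = a + 1 := by rw [← h]; abel
          rw [this]; exact hadj a }
  injective' := hf

theorem card_labelledHexagons_le :
    (labelledHexagons G).card ≤ 6 ^ 6 * countCopiesOfCycle 6 G := by
  classical
  unfold countCopiesOfCycle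
  rw [Set.ncard_eq_toFinset_card']
  let F : (Fin 6 → V) → G.Subgraph := fun f =>
    if h : Function.Injective f ∧ ∀ i, G.Adj (f i) (f (i + 1)) then
      (hexagonCopy G f h.1 h.2).toSubgraph else ⊥
  have hF : ∀ f (h : Function.Injective f ∧ ∀ i, G.Adj (f i) (f (i + 1))),
      F f = (hexagonCopy G f h.1 h.2).toSubgraph := fun f h => dif_pos h
  refine Finset.card_le_mul_card_image_of_maps_to (f := F) ?_ _ ?_
  · intro f hf
    simp only [labelledHexagons, Finset.mem_filter, Finset.mem_univ, true_and] at hf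
    rw [hF f hf, Set.mem_toFinset]
    exact ⟨(hexagonCopy G f hf.1 hf.2).isoToSubgraph.symm⟩
  · intro H hH
    rw [Set.mem_toFinset] at hH
    obtain ⟨e⟩ := hH
    have hcard : H.verts.toFinset.card = 6 := by
      rw [Set.toFinset_card]
      simpa using Fintype.card_congr e.toEquiv
    calc _ ≤ (Fintype.piFinset fun _ : Fin 6 => H.verts.toFinset).card := by
          refine Finset.card_le_card ?_
          intro f hf
          simp only [labelledHexagons, Finset.mem_filter, Finset.mem_univ, true_and] at hf
          rw [Fintype.mem_piFinset]
          intro i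
          rw [Set.mem_toFinset, ← hf.2, hF f hf.1]
          simp [Copy.toSubgraph, hexagonCopy]
      _ = 6 ^ 6 := by simp [Fintype.card_piFinset, hcard]

variable {G}

theorem mem_labelledHexagons_of_coloring {col : V → Bool}
    (hcol : ∀ u v, G.Adj u v → col u ≠ col v) {x₁ y₁ x₂ y₂ x₃ y₃ : V}
    (h1 : G.Adj x₁ y₁) (h2 : G.Adj y₁ x₂) (h3 : G.Adj x₂ y₂) (h4 : G.Adj y₂ x₃)
    (h5 : G.Adj x₃ y₃) (h6 : G.Adj y₃ x₁) (hx12 : x₁ ≠ x₂) (hx13 : x₁ ≠ x₃) (hx23 : x₂ ≠ x₃)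
    (hy12 : y₁ ≠ y₂) (hy13 : y₁ ≠ y₃) (hy23 : y₂ ≠ y₃) :
    ![x₁, y₁, x₂, y₂, x₃, y₃] ∈ labelledHexagons G := by
  have c1 := hcol _ _ h1
  have c2 := hcol _ _ h2
  have c3 := hcol _ _ h3
  have c4 := hcol _ _ h4
  have c5 := hcol _ _ h5
  have c6 := hcol _ _ h6
  have n14 : x₁ ≠ y₂ := fun h => by
    have := congrArg col h
    cases e1 : col x₁ <;> cases e2 : col y₁ <;> cases e3 : col x₂ <;> simp_all
  have n25 : y₁ ≠ x₃ := fun h => by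
    have := congrArg col h
    cases e1 : col y₁ <;> cases e2 : col x₂ <;> cases e3 : col y₂ <;> simp_all
  have n36 : x₂ ≠ y₃ := fun h => by
    have := congrArg col h
    cases e1 : col x₂ <;> cases e2 : col y₂ <;> cases e3 : col x₃ <;> simp_all
  have e1 := h1.ne
  have e2 := h2.ne
  have e3 := h3.ne
  have e4 := h4.ne
  have e5 := h5.ne
  have e6 := h6.ne
  simp only [labelledHexagons, Finset.mem_filter, Finset.mem_univ, true_and]
  constructor
  · intro i j hij
    fin_cases i <;> fin_cases j <;> simp at hij ⊢ <;> grind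
  · intro i
    fin_cases i
    exacts [h1, h2, h3, h4, h5, h6]

variable (G)

/-- The number of common neighbours. -/
def codegree (u v : V) : ℕ := (G.neighborFinset u ∩ G.neighborFinset v).card

/-- The second neighbours of `x` through `y` having codegree at least `D` with `x`. -/
def heavyNeighbors (D : ℕ) (x y : V) : Finset V :=
  {u ∈ G.neighborFinset y | u ≠ x ∧ D ≤ codegree G u x}

/-- The second neighbours of `x` through `y` having codegree less than `D` with `x`. -/
def lightNeighbors (D : ℕ) (x y : V) : Finset V :=
  {u ∈ G.neighborFinset y | u ≠ x ∧ codegree G u x < D}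

variable {G}

theorem le_card_heavyNeighbors_or_le_card_lightNeighbors {D s : ℕ} {x y : V}
    (hxy : G.Adj x y) (hs : 2 * s ≤ G.degree y) :
    s ≤ (heavyNeighbors G D x y).card ∨ s ≤ (lightNeighbors G D x y).card := by
  have hsub : (G.neighborFinset y).erase x ⊆ heavyNeighbors G D x y ∪ lightNeighbors G D x y := by
    intro u hu
    simp only [heavyNeighbors, lightNeighbors, Finset.mem_union, Finset.mem_filter]
    rw [Finset.mem_erase] at hu
    rcases le_or_gt D (codegree G u x) with h | h
    · exact Or.inl ⟨hu.2, hu.1, h⟩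
    · exact Or.inr ⟨hu.2, hu.1, h⟩
  have h1 := (Finset.card_le_card hsub).trans (Finset.card_union_le _ _)
  rw [Finset.card_erase_of_mem (by simpa using hxy.symm), card_neighborFinset_eq_degree] at h1
  omega

theorem card_mul_le_card_labelledHexagons_of_heavy {col : V → Bool}
    (hcol : ∀ u v, G.Adj u v → col u ≠ col v) {Q : Finset (V × V)} {s D : ℕ}
    (hs : ∀ p ∈ Q, s ≤ (heavyNeighbors G D p.1 p.2).card) :
    Q.card * (s * ((s - 1) * ((D - 1) * (D - 2)))) ≤ (labelledHexagons G).card := by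
  let N := fun v => G.neighborFinset v
  let H := fun p : V × V => heavyNeighbors G D p.1 p.2
  let T := Q.sigma fun p => (H p).sigma fun u => ((H p).erase u).sigma fun u' =>
    ((N u ∩ N p.1).erase p.2).sigma fun c => ((N u' ∩ N p.1).erase p.2).erase c
  have hT : Q.card * (s * ((s - 1) * ((D - 1) * (D - 2)))) ≤ T.card := by
    simp only [T, Finset.card_sigma]
    rw [← smul_eq_mul]
    refine Finset.card_nsmul_le_sum _ _ _ fun p hp => ?_
    refine (Nat.mul_le_mul_right _ (hs p hp)).trans ?_
    rw [← smul_eq_mul]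
    refine Finset.card_nsmul_le_sum _ _ _ fun u hu => ?_
    have h1 : s - 1 ≤ ((H p).erase u).card := by
      rw [Finset.card_erase_of_mem hu]
      exact Nat.sub_le_sub_right (hs p hp) 1
    refine (Nat.mul_le_mul_right _ h1).trans ?_
    rw [← smul_eq_mul]
    refine Finset.card_nsmul_le_sum _ _ _ fun u' hu' => ?_
    have h2 : D ≤ (N u ∩ N p.1).card := by
      simp only [heavyNeighbors, Finset.mem_filter] at hu
      exact hu.2.2
    have h2' : D ≤ (N u' ∩ N p.1).card := by
      have hu'' := Finset.mem_of_mem_erase hu'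
      simp only [H, heavyNeighbors, Finset.mem_filter] at hu''
      exact hu''.2.2
    have h3 : D - 1 ≤ ((N u ∩ N p.1).erase p.2).card := by
      have := Finset.pred_card_le_card_erase (s := N u ∩ N p.1) (a := p.2)
      omega
    refine (Nat.mul_le_mul_right _ h3).trans ?_
    rw [← smul_eq_mul]
    refine Finset.card_nsmul_le_sum _ _ _ fun c _ => ?_
    have h4 := Finset.pred_card_le_card_erase (s := N u' ∩ N p.1) (a := p.2)
    have h5 := Finset.pred_card_le_card_erase (s := (N u' ∩ N p.1).erase p.2) (a := c)
    omega
  refine hT.trans ?_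
  refine Finset.card_le_card_of_injOn
    (fun z => ![z.1.1, z.2.2.2.1, z.2.1, z.1.2, z.2.2.1, z.2.2.2.2]) ?_ ?_
  · rintro ⟨⟨a, b⟩, u, u', c, c'⟩ hz
    simp only [T, H, N, heavyNeighbors, Finset.coe_sigma, Set.mem_sigma_iff, Finset.mem_coe,
      Finset.mem_filter, Finset.mem_erase, Finset.mem_inter, mem_neighborFinset] at hz
    obtain ⟨hp, ⟨hu, hua, -⟩, ⟨hu'u, hu', hu'a, -⟩, ⟨hcb, hcu, hca⟩, hc'c, hc'b, hc'u, hc'a⟩ := hz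
    exact mem_labelledHexagons_of_coloring hcol hca hcu.symm hu.symm hu' hc'u hc'a.symm
      hua.symm hu'a.symm hu'u.symm hcb hc'c.symm hc'b.symm
  · rintro ⟨⟨a, b⟩, u, u', c, c'⟩ - ⟨⟨a₂, b₂⟩, u₂, u₂', c₂, c₂'⟩ - h
    have h0 := congrFun h 0
    have h1 := congrFun h 1
    have h2 := congrFun h 2
    have h3 := congrFun h 3
    have h4 := congrFun h 4
    have h5 := congrFun h 5
    simp at h0 h1 h2 h3 h4 h5
    subst h0 h1 h2 h3 h4 h5
    rfl

theorem sq_card_le_of_light {col : V → Bool}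
    (hcol : ∀ u v, G.Adj u v → col u ≠ col v) {A B : Finset V} {P : Finset (V × V × V × V)}
    {D : ℕ} (hP : ∀ p ∈ P, p.1 ∈ A ∧ p.2.2.2 ∈ B ∧ G.Adj p.2.2.1 p.2.1 ∧
      p.1 ∈ lightNeighbors G D p.2.2.1 p.2.1 ∧ p.2.2.2 ∈ lightNeighbors G D p.2.1 p.2.2.1) :
    P.card ^ 2 ≤ A.card * B.card * ((labelledHexagons G).card + 2 * (P.card * D)) := by
  let π : V × V × V × V → V × V := fun p => (p.1, p.2.2.2)
  have hfib : P.card = ∑ x ∈ A ×ˢ B, (P.filter fun p => π p = x).card :=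
    Finset.card_eq_sum_card_fiberwise fun p hp => by
      have := hP p hp
      simp only [π, Finset.coe_product, Set.mem_prod, Finset.mem_coe]
      exact ⟨this.1, this.2.1⟩
  let W := (P ×ˢ P).filter fun z => π z.1 = π z.2
  have hW : ∑ x ∈ A ×ˢ B, (P.filter fun p => π p = x).card ^ 2 ≤ W.card := by
    have : ∀ x, (P.filter fun p => π p = x).card ^ 2 =
        ((P.filter fun p => π p = x) ×ˢ (P.filter fun p => π p = x)).card := by
      intro x; rw [Finset.card_product, sq]
    simp only [this]
    rw [← Finset.card_biUnion]
    · refine Finset.card_le_card ?_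
      intro z hz
      simp only [Finset.mem_biUnion, Finset.mem_product, Finset.mem_filter] at hz
      obtain ⟨x, -, h1, h2⟩ := hz
      simp only [W, Finset.mem_filter, Finset.mem_product]
      exact ⟨⟨h1.1, h2.1⟩, h1.2.trans h2.2.symm⟩
    · intro x _ y _ hxy
      rw [Function.onFun, Finset.disjoint_left]
      intro z hz hz'
      simp only [Finset.mem_product, Finset.mem_filter] at hz hz'
      exact hxy (hz.1.2.symm.trans hz'.1.2)
  have hsplit : W ⊆ (W.filter fun z => z.1.2.2.1 ≠ z.2.2.2.1 ∧ z.1.2.1 ≠ z.2.2.1) ∪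
      (W.filter fun z => z.1.2.2.1 = z.2.2.2.1) ∪ (W.filter fun z => z.1.2.1 = z.2.2.1) := by
    intro z hz
    simp only [Finset.mem_union, Finset.mem_filter]
    tauto
  have hhex : (W.filter fun z => z.1.2.2.1 ≠ z.2.2.2.1 ∧ z.1.2.1 ≠ z.2.2.1).card ≤
      (labelledHexagons G).card := by
    refine Finset.card_le_card_of_injOn
      (fun z => ![z.1.1, z.1.2.1, z.1.2.2.1, z.1.2.2.2, z.2.2.2.1, z.2.2.1]) ?_ ?_
    · rintro ⟨⟨u, b, a, v⟩, ⟨u', b', a', v'⟩⟩ hz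
      simp only [Finset.mem_coe, W, Finset.mem_filter, Finset.mem_product, π,
        Prod.mk.injEq] at hz
      obtain ⟨⟨⟨hp, hp'⟩, rfl, rfl⟩, ha, hb⟩ := hz
      have h := hP _ hp
      have h' := hP _ hp'
      simp only [lightNeighbors, Finset.mem_filter, mem_neighborFinset] at h h'
      obtain ⟨-, -, hab, ⟨hu, hua, -⟩, hv, hvb, -⟩ := h
      obtain ⟨-, -, hab', ⟨hu', hua', -⟩, hv', hvb', -⟩ := h'
      exact mem_labelledHexagons_of_coloring hcol hu.symm hab.symm hv hv'.symm hab' hu'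
        hua hua' ha hvb.symm hb hvb'
    · rintro ⟨⟨u, b, a, v⟩, ⟨u', b', a', v'⟩⟩ hz ⟨⟨u₂, b₂, a₂, v₂⟩, ⟨u₂', b₂', a₂', v₂'⟩⟩ hz₂ h
      simp only [Finset.mem_coe, W, Finset.mem_filter, Finset.mem_product, π,
        Prod.mk.injEq] at hz hz₂
      obtain ⟨⟨-, rfl, rfl⟩, -⟩ := hz
      obtain ⟨⟨-, rfl, rfl⟩, -⟩ := hz₂
      have h0 := congrFun h 0
      have h1 := congrFun h 1
      have h2 := congrFun h 2
      have h3 := congrFun h 3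
      have h4 := congrFun h 4
      have h5 := congrFun h 5
      simp at h0 h1 h2 h3 h4 h5
      subst h0 h1 h2 h3 h4 h5
      rfl
  have hdegA : (W.filter fun z => z.1.2.2.1 = z.2.2.2.1).card ≤ P.card * D := by
    calc _ ≤ (P.sigma fun p => G.neighborFinset p.1 ∩ G.neighborFinset p.2.2.1).card := by
          refine Finset.card_le_card_of_injOn (fun z => ⟨z.1, z.2.2.1⟩) ?_ ?_
          · rintro ⟨⟨u, b, a, v⟩, ⟨u', b', a', v'⟩⟩ hz
            simp only [Finset.mem_coe, W, Finset.mem_filter,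
              Finset.mem_product, π, Prod.mk.injEq] at hz
            obtain ⟨⟨⟨hp, hp'⟩, rfl, rfl⟩, rfl⟩ := hz
            have h' := hP _ hp'
            simp only [lightNeighbors, Finset.mem_filter, mem_neighborFinset] at h'
            simp only [Finset.coe_sigma, Set.mem_sigma_iff, Finset.mem_coe, Finset.mem_inter,
              mem_neighborFinset]
            exact ⟨hp, h'.2.2.2.1.1.symm, h'.2.2.1⟩
          · rintro ⟨⟨u, b, a, v⟩, ⟨u', b', a', v'⟩⟩ hz ⟨⟨u₂, b₂, a₂, v₂⟩, ⟨u₂', b₂', a₂', v₂'⟩⟩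
              hz₂ h
            simp only [Finset.mem_coe, W, Finset.mem_filter,
              Finset.mem_product, π, Prod.mk.injEq] at hz hz₂
            simp only [Sigma.mk.injEq, Prod.mk.injEq, heq_eq_eq] at h
            grind
      _ ≤ P.card * D := by
          rw [Finset.card_sigma, ← smul_eq_mul]
          refine Finset.sum_le_card_nsmul _ _ _ fun p hp => ?_
          have h := (hP p hp).2.2.2.1
          simp only [lightNeighbors, Finset.mem_filter] at h
          exact h.2.2.le
  have hdegB : (W.filter fun z => z.1.2.1 = z.2.2.1).card ≤ P.card * D := by
    calc _ ≤ (P.sigma fun p => G.neighborFinset p.2.2.2 ∩ G.neighborFinset p.2.1).card := by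
          refine Finset.card_le_card_of_injOn (fun z => ⟨z.1, z.2.2.2.1⟩) ?_ ?_
          · rintro ⟨⟨u, b, a, v⟩, ⟨u', b', a', v'⟩⟩ hz
            simp only [Finset.mem_coe, W, Finset.mem_filter,
              Finset.mem_product, π, Prod.mk.injEq] at hz
            obtain ⟨⟨⟨hp, hp'⟩, rfl, rfl⟩, rfl⟩ := hz
            have h' := hP _ hp'
            simp only [lightNeighbors, Finset.mem_filter, mem_neighborFinset] at h'
            simp only [Finset.coe_sigma, Set.mem_sigma_iff, Finset.mem_coe, Finset.mem_inter,
              mem_neighborFinset]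
            exact ⟨hp, h'.2.2.2.2.1.symm, h'.2.2.1.symm⟩
          · rintro ⟨⟨u, b, a, v⟩, ⟨u', b', a', v'⟩⟩ hz ⟨⟨u₂, b₂, a₂, v₂⟩, ⟨u₂', b₂', a₂', v₂'⟩⟩
              hz₂ h
            simp only [Finset.mem_coe, W, Finset.mem_filter,
              Finset.mem_product, π, Prod.mk.injEq] at hz hz₂
            simp only [Sigma.mk.injEq, Prod.mk.injEq, heq_eq_eq] at h
            grind
      _ ≤ P.card * D := by
          rw [Finset.card_sigma, ← smul_eq_mul]
          refine Finset.sum_le_card_nsmul _ _ _ fun p hp => ?_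
          have h := (hP p hp).2.2.2.2
          simp only [lightNeighbors, Finset.mem_filter] at h
          exact h.2.2.le
  have hWle : W.card ≤ (labelledHexagons G).card + 2 * (P.card * D) := by
    have h1 := (Finset.card_le_card hsplit).trans (Finset.card_union_le _ _)
    have h2 := Finset.card_union_le
      (W.filter fun z => z.1.2.2.1 ≠ z.2.2.2.1 ∧ z.1.2.1 ≠ z.2.2.1)
      (W.filter fun z => z.1.2.2.1 = z.2.2.2.1)
    omega
  calc P.card ^ 2 = (∑ x ∈ A ×ˢ B, (P.filter fun p => π p = x).card) ^ 2 := by rw [← hfib]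
    _ ≤ (A ×ˢ B).card * ∑ x ∈ A ×ˢ B, (P.filter fun p => π p = x).card ^ 2 :=
        sq_sum_le_card_mul_sum_sq
    _ ≤ _ := by
        rw [Finset.card_product]
        exact Nat.mul_le_mul_left _ (hW.trans hWle)

theorem card_edgeFinset_le_two_mul_card {A B : Finset V}
    (hAB : ∀ u v : V, G.Adj u v → (u ∈ A ∧ v ∈ B) ∨ (u ∈ B ∧ v ∈ A)) {r s : ℕ}
    (hr : 8 * (r * A.card) ≤ G.edgeFinset.card) (hs : 8 * (s * B.card) ≤ G.edgeFinset.card) :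
    G.edgeFinset.card ≤ 2 * ((A ×ˢ B).filter fun p =>
      G.Adj p.1 p.2 ∧ 2 * r ≤ G.degree p.1 ∧ 2 * s ≤ G.degree p.2).card := by
  let E := (A ×ˢ B).filter fun p => G.Adj p.1 p.2
  have hE : G.edgeFinset.card ≤ E.card := by
    refine (Finset.card_le_card (t := E.image fun p => s(p.1, p.2)) ?_).trans Finset.card_image_le
    intro e
    induction e using Sym2.ind with
    | _ u v =>
      intro he
      rw [mem_edgeFinset, mem_edgeSet] at he
      simp only [E, Finset.mem_image, Finset.mem_filter, Finset.mem_product]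
      rcases hAB u v he with h | h
      · exact ⟨(u, v), ⟨h, he⟩, rfl⟩
      · exact ⟨(v, u), ⟨h.symm, he.symm⟩, Sym2.eq_swap⟩
  have hA : (E.filter fun p => G.degree p.1 < 2 * r).card ≤ 2 * r * A.card := by
    refine Finset.card_le_mul_card_image_of_maps_to (f := Prod.fst) ?_ _ fun a _ => ?_
    · intro p hp
      simp only [E, Finset.mem_filter, Finset.mem_product] at hp
      exact hp.1.1.1
    · rcases lt_or_ge (G.degree a) (2 * r) with h | h
      · rw [← card_neighborFinset_eq_degree] at h
        refine le_trans (Finset.card_le_card_of_injOn Prod.snd ?_ ?_) h.le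
        · intro p hp
          simp only [E, Finset.mem_coe, Finset.mem_filter] at hp
          simp only [Finset.mem_coe, mem_neighborFinset]
          exact hp.2 ▸ hp.1.1.2
        · intro p hp p' hp' h
          simp only [Finset.mem_coe, Finset.mem_filter] at hp hp'
          exact Prod.ext (hp.2.trans hp'.2.symm) h
      · rw [Finset.card_eq_zero.mpr]
        · exact Nat.zero_le _
        · refine Finset.filter_eq_empty_iff.mpr fun p hp hpa => ?_
          rw [Finset.mem_filter, hpa] at hp
          omega
  have hB : (E.filter fun p => G.degree p.2 < 2 * s).card ≤ 2 * s * B.card := by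
    refine Finset.card_le_mul_card_image_of_maps_to (f := Prod.snd) ?_ _ fun a _ => ?_
    · intro p hp
      simp only [E, Finset.mem_filter, Finset.mem_product] at hp
      exact hp.1.1.2
    · rcases lt_or_ge (G.degree a) (2 * s) with h | h
      · rw [← card_neighborFinset_eq_degree] at h
        refine le_trans (Finset.card_le_card_of_injOn Prod.fst ?_ ?_) h.le
        · intro p hp
          simp only [E, Finset.mem_coe, Finset.mem_filter] at hp
          simp only [Finset.mem_coe, mem_neighborFinset]
          exact hp.2 ▸ hp.1.1.2.symm
        · intro p hp p' hp' h
          simp only [Finset.mem_coe, Finset.mem_filter] at hp hp'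
          exact Prod.ext h (hp.2.trans hp'.2.symm)
      · rw [Finset.card_eq_zero.mpr]
        · exact Nat.zero_le _
        · refine Finset.filter_eq_empty_iff.mpr fun p hp hpa => ?_
          rw [Finset.mem_filter, hpa] at hp
          omega
  have hsub : E ⊆ ((A ×ˢ B).filter fun p =>
      G.Adj p.1 p.2 ∧ 2 * r ≤ G.degree p.1 ∧ 2 * s ≤ G.degree p.2) ∪
      (E.filter fun p => G.degree p.1 < 2 * r) ∪ (E.filter fun p => G.degree p.2 < 2 * s) := by
    intro p hp
    simp only [E, Finset.mem_filter, Finset.mem_union] at hp ⊢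
    by_cases h1 : G.degree p.1 < 2 * r
    · exact Or.inl (Or.inr ⟨hp, h1⟩)
    by_cases h2 : G.degree p.2 < 2 * s
    · exact Or.inr ⟨hp, h2⟩
    exact Or.inl (Or.inl ⟨hp.1, hp.2, not_lt.mp h1, not_lt.mp h2⟩)
  have h1 := (Finset.card_le_card hsub).trans (Finset.card_union_le _ _)
  have h2 := Finset.card_union_le ((A ×ˢ B).filter fun p =>
      G.Adj p.1 p.2 ∧ 2 * r ≤ G.degree p.1 ∧ 2 * s ≤ G.degree p.2)
      (E.filter fun p => G.degree p.1 < 2 * r)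
  rw [mul_assoc] at hA hB
  omega

theorem labelledHexagons_trichotomy {A B : Finset V} (hdisj : Disjoint A B)
    (hAB : ∀ u v : V, G.Adj u v → (u ∈ A ∧ v ∈ B) ∨ (u ∈ B ∧ v ∈ A)) {r s : ℕ} (D : ℕ)
    (hr : 8 * (r * A.card) ≤ G.edgeFinset.card) (hs : 8 * (s * B.card) ≤ G.edgeFinset.card) :
    ∃ q : ℕ, G.edgeFinset.card ≤ 6 * q ∧
      (q * (s * ((s - 1) * ((D - 1) * (D - 2)))) ≤ (labelledHexagons G).card ∨
       q * (r * ((r - 1) * ((D - 1) * (D - 2)))) ≤ (labelledHexagons G).card ∨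
       ∃ P : ℕ, q * (s * r) ≤ P ∧
        P ^ 2 ≤ A.card * B.card * ((labelledHexagons G).card + 2 * (P * D))) := by
  have hcol : ∀ u v, G.Adj u v → decide (u ∈ A) ≠ decide (v ∈ A) := by
    intro u v huv
    rcases hAB u v huv with h | h
    · simp [h.1, Finset.disjoint_right.mp hdisj h.2]
    · simp [h.2, Finset.disjoint_right.mp hdisj h.1]
  let E := (A ×ˢ B).filter fun p =>
      G.Adj p.1 p.2 ∧ 2 * r ≤ G.degree p.1 ∧ 2 * s ≤ G.degree p.2
  have hE : G.edgeFinset.card ≤ 2 * E.card := card_edgeFinset_le_two_mul_card hAB hr hs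
  let Q₁ := E.filter fun p => s ≤ (heavyNeighbors G D p.1 p.2).card
  let Q₂ := E.filter fun p => r ≤ (heavyNeighbors G D p.2 p.1).card
  let Q₃ := E.filter fun p =>
    s ≤ (lightNeighbors G D p.1 p.2).card ∧ r ≤ (lightNeighbors G D p.2 p.1).card
  have hsub : E ⊆ Q₁ ∪ Q₂ ∪ Q₃ := by
    intro p hp
    have hp' := hp
    simp only [E, Finset.mem_filter] at hp'
    have h1 := le_card_heavyNeighbors_or_le_card_lightNeighbors (D := D) hp'.2.1 hp'.2.2.2
    have h2 := le_card_heavyNeighbors_or_le_card_lightNeighbors (D := D) hp'.2.1.symm hp'.2.2.1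
    simp only [Q₁, Q₂, Q₃, Finset.mem_union, Finset.mem_filter]
    tauto
  have hcard : E.card ≤ Q₁.card + Q₂.card + Q₃.card :=
    (Finset.card_le_card hsub).trans ((Finset.card_union_le _ _).trans
      (Nat.add_le_add_right (Finset.card_union_le _ _) _))
  have hcases : G.edgeFinset.card ≤ 6 * Q₁.card ∨ G.edgeFinset.card ≤ 6 * Q₂.card ∨
      G.edgeFinset.card ≤ 6 * Q₃.card := by omega
  rcases hcases with h | h | h
  · refine ⟨Q₁.card, h, Or.inl ?_⟩
    refine card_mul_le_card_labelledHexagons_of_heavy (col := fun v => decide (v ∈ A)) hcol ?_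
    intro p hp
    exact (Finset.mem_filter.mp hp).2
  · refine ⟨Q₂.card, h, Or.inr (Or.inl ?_)⟩
    rw [← Finset.card_map (Equiv.prodComm V V).toEmbedding]
    refine card_mul_le_card_labelledHexagons_of_heavy (col := fun v => decide (v ∈ A)) hcol ?_
    intro p hp
    rw [Finset.mem_map_equiv] at hp
    exact (Finset.mem_filter.mp hp).2
  · refine ⟨Q₃.card, h, Or.inr (Or.inr ?_)⟩
    let T := Q₃.sigma fun p => lightNeighbors G D p.1 p.2 ×ˢ lightNeighbors G D p.2 p.1
    let f : (Σ _ : V × V, V × V) → V × V × V × V := fun z => (z.2.1, z.1.2, z.1.1, z.2.2)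
    have hf : Function.Injective f := by
      rintro ⟨⟨a, b⟩, u, v⟩ ⟨⟨a', b'⟩, u', v'⟩ h
      simp only [f, Prod.mk.injEq] at h
      obtain ⟨rfl, rfl, rfl, rfl⟩ := h
      rfl
    refine ⟨(T.image f).card, ?_, ?_⟩
    · rw [Finset.card_image_of_injective _ hf, Finset.card_sigma, ← smul_eq_mul]
      refine Finset.card_nsmul_le_sum _ _ _ fun p hp => ?_
      rw [Finset.card_product]
      have := (Finset.mem_filter.mp hp).2
      exact Nat.mul_le_mul this.1 this.2
    · refine sq_card_le_of_light (col := fun v => decide (v ∈ A)) hcol ?_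
      intro p hp
      obtain ⟨⟨⟨a, b⟩, u, v⟩, hz, rfl⟩ := Finset.mem_image.mp hp
      simp only [T, Q₃, E, Finset.mem_sigma, Finset.mem_filter, Finset.mem_product] at hz
      obtain ⟨⟨⟨⟨ha, hb⟩, hab, -⟩, -⟩, hu, hv⟩ := hz
      refine ⟨?_, ?_, hab, hu, hv⟩
      · have h1 : G.Adj b u := by
          simp only [lightNeighbors, Finset.mem_filter, mem_neighborFinset] at hu
          exact hu.1
        rcases hAB b u h1 with h | h
        · exact absurd hb (Finset.disjoint_left.mp hdisj h.1)
        · exact h.2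
      · have h1 : G.Adj a v := by
          simp only [lightNeighbors, Finset.mem_filter, mem_neighborFinset] at hv
          exact hv.1
        rcases hAB a v h1 with h | h
        · exact h.2
        · exact absurd h.1 (Finset.disjoint_left.mp hdisj ha)

end Hexagons

theorem div_sixteen_le_floor_sub_one {x : ℝ} (hx : 32 ≤ x) :
    x / 16 ≤ ((⌊x / 8⌋₊ - 1 : ℕ) : ℝ) ∧ x / 16 ≤ (⌊x / 8⌋₊ : ℝ) := by
  have h1 := Nat.lt_floor_add_one (x / 8)
  have h2 : 1 ≤ ⌊x / 8⌋₊ := Nat.le_floor (by norm_num; linarith)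
  rw [Nat.cast_sub h2]
  constructor <;> push_cast <;> linarith

theorem heavy_count_lower_bound {m x q : ℝ} {e s D h : ℕ} (hx : 0 ≤ x) (hq : 0 ≤ q)
    (he : m ≤ 6 * (e : ℝ)) (hs : x / 16 ≤ (s : ℝ)) (hs' : x / 16 ≤ ((s - 1 : ℕ) : ℝ))
    (hD : q / 12288 ≤ ((D - 1 : ℕ) : ℝ)) (hD' : q / 12288 ≤ ((D - 2 : ℕ) : ℝ))
    (hh : e * (s * ((s - 1) * ((D - 1) * (D - 2)))) ≤ h) :
    m / 6 * (x / 16 * (x / 16 * (q / 12288 * (q / 12288)))) ≤ (h : ℝ) := by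
  have hh' : ((e * (s * ((s - 1) * ((D - 1) * (D - 2)))) : ℕ) : ℝ) ≤ (h : ℝ) := by exact_mod_cast hh
  refine le_trans ?_ hh'
  simp only [Nat.cast_mul]
  have : m / 6 ≤ e := by linarith
  gcongr

theorem light_count_lower_bound {L R m x y q h P D : ℝ} (hL : 0 < L) (hR : 0 < R)
    (hq : 0 < q) (hmx : m * x * y = L * R * q) (hP : m / 6 * (y / 16 * (x / 16)) ≤ P)
    (hD : D ≤ q / 6144) (hh : P ^ 2 ≤ L * R * (h + 2 * (P * D))) :
    L * R * q ^ 2 / (2 * 1536 ^ 2) ≤ h := by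
  have hLR : 0 < L * R := mul_pos hL hR
  have hP' : L * R * (q / 1536) ≤ P := by
    refine le_trans (le_of_eq ?_) hP
    linear_combination -hmx / 1536
  have hP0 : 0 < P := lt_of_lt_of_le (by positivity) hP'
  have h1 : L * R * (2 * (P * D)) ≤ P ^ 2 / 2 := by
    calc L * R * (2 * (P * D)) ≤ L * R * (2 * (P * (q / 6144))) := by gcongr
      _ = P * (L * R * (q / 1536)) / 2 := by ring
      _ ≤ P * P / 2 := by gcongr
      _ = P ^ 2 / 2 := by ring
  have h2 : P ^ 2 / 2 ≤ L * R * h := by linarith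
  have h3 : (L * R * (q / 1536)) ^ 2 ≤ P ^ 2 := by gcongr
  refine le_of_mul_le_mul_left ?_ hLR
  calc L * R * (L * R * q ^ 2 / (2 * 1536 ^ 2)) = (L * R * (q / 1536)) ^ 2 / 2 := by ring
    _ ≤ P ^ 2 / 2 := by gcongr
    _ ≤ L * R * h := h2


theorem le_of_labelledHexagons_cases {L R m x y q h : ℝ} (hL : 0 < L) (hR : 0 < R)
    (hx : 0 < x) (hy : 0 < y) (hyx : y ≤ x) (hmL : m = L * x) (hmR : m = R * y)
    (hq : q = x * y ^ 2 / L)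
    (hcases : m / 6 * (y / 16 * (y / 16 * (q / 12288 * (q / 12288)))) ≤ h ∨
      m / 6 * (x / 16 * (x / 16 * (q / 12288 * (q / 12288)))) ≤ h ∨
      L * R * q ^ 2 / (2 * 1536 ^ 2) ≤ h) :
    y ^ 3 * x ^ 3 * min 1 (y ^ 3 / L) / 10 ^ 13 ≤ h := by
  have hm : 0 < m := hmL ▸ mul_pos hL hx
  have hq0 : 0 < q := by rw [hq]; positivity
  have hheavy : y ^ 3 * x ^ 3 * min 1 (y ^ 3 / L) / 10 ^ 13 ≤
      m / 6 * (y / 16 * (y / 16 * (q / 12288 * (q / 12288)))) := by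
    have h1 : m / 6 * (y / 16 * (y / 16 * (q / 12288 * (q / 12288)))) =
        y ^ 3 * x ^ 3 * (y ^ 3 / L) / (6 * 16 ^ 2 * 12288 ^ 2) := by
      rw [hq, hmL]; field_simp
    rw [h1]
    gcongr
    · exact min_le_right _ _
    · norm_num
  rcases hcases with h1 | h1 | h1
  · exact hheavy.trans h1
  · refine hheavy.trans (le_trans ?_ h1)
    gcongr
  · refine le_trans ?_ h1
    have h2 : L * R * q ^ 2 = y ^ 3 * x ^ 3 * 1 := by
      have h3 : L * R * q ^ 2 = (R * y) * y ^ 3 * x ^ 2 / L := by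
        rw [hq]; field_simp
      rw [h3, ← hmR, hmL]; field_simp
    rw [h2]
    gcongr
    · exact min_le_left _ _
    · norm_num

theorem pow_le_of_dense {L R m x y q K : ℝ} (hL : 0 < L) (hR : 0 < R) (hK : 0 < K)
    (hmL : m = L * x) (hmR : m = R * y) (hq : q = x * y ^ 2 / L)
    (hm : K * (L + R + (L * R) ^ ((2 : ℝ) / 3)) ≤ m) : K ≤ y ∧ K ^ 3 ≤ q := by
  have hw0 : 0 ≤ (L * R) ^ ((2 : ℝ) / 3) := by positivity
  have hKL : 0 < K * L := mul_pos hK hL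
  have hKR : 0 < K * R := mul_pos hK hR
  have hKw : 0 ≤ K * (L * R) ^ ((2 : ℝ) / 3) := mul_nonneg hK.le hw0
  rw [mul_add, mul_add] at hm
  constructor
  · refine le_of_mul_le_mul_left ?_ hR
    rw [← hmR]; linarith
  · have h1 : K * (L * R) ^ ((2 : ℝ) / 3) ≤ m := by linarith
    have h2 : (K * (L * R) ^ ((2 : ℝ) / 3)) ^ 3 ≤ m ^ 3 := by gcongr
    have h3 : ((L * R) ^ ((2 : ℝ) / 3)) ^ 3 = (L * R) ^ 2 := by
      rw [← Real.rpow_natCast, ← Real.rpow_mul (by positivity)]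
      norm_num
    have hmxy : m * x * y = L * R * q := by
      rw [hq, hmR]; field_simp
    have h4 : m ^ 3 = q * (L * R) ^ 2 := by
      calc m ^ 3 = m * (L * x) * (R * y) := by rw [← hmL, ← hmR]; ring
        _ = (m * x * y) * (L * R) := by ring
        _ = q * (L * R) ^ 2 := by rw [hmxy]; ring
    rw [mul_pow, h3, h4] at h2
    exact le_of_mul_le_mul_right h2 (by positivity)

theorem div_12288_le_floor_sub {q : ℝ} (hq : 2 ^ 30 ≤ q) :
    q / 12288 ≤ ((⌊q / 6144⌋₊ - 1 : ℕ) : ℝ) ∧ q / 12288 ≤ ((⌊q / 6144⌋₊ - 2 : ℕ) : ℝ) := by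
  have hlt := Nat.lt_floor_add_one (q / 6144)
  have h2 : 2 ≤ ⌊q / 6144⌋₊ := Nat.le_floor (by norm_num at hq ⊢; linarith)
  rw [Nat.cast_sub (by omega), Nat.cast_sub (by omega)]
  norm_num at hq ⊢
  constructor <;> linarith

theorem le_card_labelledHexagons {V : Type*} [Fintype V] [DecidableEq V] {G : SimpleGraph V}
    [DecidableRel G.Adj] {A B : Finset V} (hdisj : Disjoint A B)
    (hAB : ∀ u v : V, G.Adj u v → (u ∈ A ∧ v ∈ B) ∨ (u ∈ B ∧ v ∈ A)) {L R m x y q : ℝ}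
    (hLA : L = A.card) (hRB : R = B.card) (hmG : m = G.edgeFinset.card) (hL : 0 < L) (hR : 0 < R)
    (hmL : m = L * x) (hmR : m = R * y) (hy : 32 ≤ y) (hyx : y ≤ x)
    (hq : q = x * y ^ 2 / L) (hqbig : 2 ^ 30 ≤ q) :
    y ^ 3 * x ^ 3 * min 1 (y ^ 3 / L) / 10 ^ 13 ≤ ((labelledHexagons G).card : ℝ) := by
  have hypos : 0 < y := by linarith
  have hxpos : 0 < x := by linarith
  have hqpos : 0 < q := lt_of_lt_of_le (by positivity) hqbig
  have hmxy : m * x * y = L * R * q := by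
    rw [hq, hmR]; field_simp
  have hsy := div_sixteen_le_floor_sub_one hy
  have hrx := div_sixteen_le_floor_sub_one (hy.trans hyx)
  have hDle : (⌊q / 6144⌋₊ : ℝ) ≤ q / 6144 := Nat.floor_le (by positivity)
  have hD := div_12288_le_floor_sub hqbig
  have hr : 8 * (⌊x / 8⌋₊ * A.card) ≤ G.edgeFinset.card := by
    have h1 : (⌊x / 8⌋₊ : ℝ) ≤ x / 8 := Nat.floor_le (by positivity)
    have h2 : (8 : ℝ) * (⌊x / 8⌋₊ * A.card) ≤ G.edgeFinset.card := by
      rw [← hLA, ← hmG, hmL]; nlinarith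
    exact_mod_cast h2
  have hs : 8 * (⌊y / 8⌋₊ * B.card) ≤ G.edgeFinset.card := by
    have h1 : (⌊y / 8⌋₊ : ℝ) ≤ y / 8 := Nat.floor_le (by positivity)
    have h2 : (8 : ℝ) * (⌊y / 8⌋₊ * B.card) ≤ G.edgeFinset.card := by
      rw [← hRB, ← hmG, hmR]; nlinarith
    exact_mod_cast h2
  obtain ⟨e, he, hcases⟩ := labelledHexagons_trichotomy hdisj hAB ⌊q / 6144⌋₊ hr hs
  have he' : m ≤ 6 * (e : ℝ) := by rw [hmG]; exact_mod_cast he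
  refine le_of_labelledHexagons_cases hL hR hxpos hypos hyx hmL hmR hq ?_
  rcases hcases with h | h | ⟨P, hP, h⟩
  · exact Or.inl (heavy_count_lower_bound hypos.le hqpos.le he' hsy.2 hsy.1 hD.1 hD.2 h)
  · exact Or.inr (Or.inl
      (heavy_count_lower_bound hxpos.le hqpos.le he' hrx.2 hrx.1 hD.1 hD.2 h))
  · refine Or.inr (Or.inr (light_count_lower_bound hL hR hqpos hmxy (P := P)
      (D := ⌊q / 6144⌋₊) ?_ hDle ?_))
    · have hP' : ((e * (⌊y / 8⌋₊ * ⌊x / 8⌋₊) : ℕ) : ℝ) ≤ (P : ℝ) := by exact_mod_cast hP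
      refine le_trans ?_ hP'
      simp only [Nat.cast_mul]
      have := hsy.2
      have := hrx.2
      have : m / 6 ≤ e := by linarith
      gcongr
    · rw [hLA, hRB]
      exact_mod_cast h

/-- Partial unbalanced supersaturation for hexagons (Theorem `partialsupersat`). -/
theorem partial_supersaturation_hexagons :
    ∃ c : ℝ, 0 < c ∧
      ∀ (V : Type) [Fintype V] [DecidableEq V] (G : SimpleGraph V) [DecidableRel G.Adj]
        (A B : Finset V), Disjoint A B → A ∪ B = Finset.univ →
        (∀ u v : V, G.Adj u v → (u ∈ A ∧ v ∈ B) ∨ (u ∈ B ∧ v ∈ A)) →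
        ∀ (L R m t n : ℕ) (dL dR : ℝ),
          L = A.card → R = B.card → m = G.edgeFinset.card → t = countCopiesOfCycle 6 G →
          n = 2 ^ Nat.clog 2 (L + R) →
          dL = (m : ℝ) / (L : ℝ) → dR = (m : ℝ) / (R : ℝ) →
          100 ≤ L → L ≤ R →
          (m : ℝ) / (Nat.clog 2 (L + R) : ℝ) ^ 10 >
            (L : ℝ) + (R : ℝ) + ((L : ℝ) * (R : ℝ)) ^ ((2 : ℝ) / 3) →
          (t : ℝ) ≥ c * dR ^ 3 * dL ^ 3 *
            min 1 (min (dR ^ 3 / (L : ℝ)) (dL ^ 2 * dR ^ 2 / (L : ℝ) ^ 2)) /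
            (Real.logb 2 (n : ℝ)) ^ 70 := by
  refine ⟨1 / 10 ^ 18, by norm_num, ?_⟩
  intro V _ _ G _ A B hdisj _ hAB L R m t n x y hLA hRB hmG ht hn hx hy hL hLR hdense
  generalize hk : Nat.clog 2 (L + R) = k at hdense hn
  have hk8 : 8 ≤ k := by
    rw [← hk]
    exact (Nat.lt_clog_iff_pow_lt (by norm_num)).mpr (by omega : 2 ^ 7 < L + R)
  have hk8' : (8 : ℝ) ≤ k := by exact_mod_cast hk8
  have hlog : Real.logb 2 (n : ℝ) = k := by
    rw [hn]; push_cast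
    rw [Real.logb_pow, Real.logb_self_eq_one (by norm_num), mul_one]
  have hL0 : (100 : ℝ) ≤ L := by exact_mod_cast hL
  have hLR' : (L : ℝ) ≤ R := by exact_mod_cast hLR
  have hLpos : (0 : ℝ) < L := by linarith
  have hRpos : (0 : ℝ) < R := by linarith
  have hmbig : 2 ^ 30 * ((L : ℝ) + R + ((L : ℝ) * R) ^ ((2 : ℝ) / 3)) ≤ m := by
    have hk10 : (2 : ℝ) ^ 30 ≤ (k : ℝ) ^ 10 := by
      calc (2 : ℝ) ^ 30 = 8 ^ 10 := by norm_num
        _ ≤ (k : ℝ) ^ 10 := by gcongr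
    rw [gt_iff_lt, lt_div_iff₀ (by positivity)] at hdense
    refine le_trans ?_ hdense.le
    rw [mul_comm]
    gcongr
  have hmL : (m : ℝ) = L * x := by rw [hx]; field_simp
  have hmR : (m : ℝ) = R * y := by rw [hy]; field_simp
  have hyx : y ≤ x := by
    rw [hx, hy]
    gcongr
  obtain ⟨hybig, hqbig⟩ := pow_le_of_dense hLpos hRpos (by norm_num) hmL hmR rfl hmbig
  have hypos : 0 < y := lt_of_lt_of_le (by norm_num) hybig
  have hxpos : 0 < x := hypos.trans_le hyx
  have hhex := le_card_labelledHexagons hdisj hAB (by rw [hLA]) (by rw [hRB]) (by rw [hmG])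
    hLpos hRpos hmL hmR (le_trans (by norm_num) hybig) hyx rfl (le_trans (by norm_num) hqbig)
  have hcount : ((labelledHexagons G).card : ℝ) ≤ 6 ^ 6 * (t : ℝ) := by
    rw [ht]
    exact_mod_cast card_labelledHexagons_le G
  have hmin : min 1 (min (y ^ 3 / (L : ℝ)) (x ^ 2 * y ^ 2 / (L : ℝ) ^ 2)) ≤
      min 1 (y ^ 3 / (L : ℝ)) := min_le_min_left _ (min_le_left _ _)
  have hmin0 : 0 ≤ min 1 (y ^ 3 / (L : ℝ)) := by positivity
  rw [hlog, ge_iff_le]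
  calc 1 / 10 ^ 18 * y ^ 3 * x ^ 3 *
        min 1 (min (y ^ 3 / (L : ℝ)) (x ^ 2 * y ^ 2 / (L : ℝ) ^ 2)) / (k : ℝ) ^ 70
      ≤ 1 / 10 ^ 18 * y ^ 3 * x ^ 3 *
        min 1 (min (y ^ 3 / (L : ℝ)) (x ^ 2 * y ^ 2 / (L : ℝ) ^ 2)) :=
        div_le_self (by positivity) (one_le_pow₀ (by linarith))
    _ ≤ 1 / 10 ^ 18 * y ^ 3 * x ^ 3 * min 1 (y ^ 3 / (L : ℝ)) := by gcongr
    _ = y ^ 3 * x ^ 3 * min 1 (y ^ 3 / L) / 10 ^ 13 / 10 ^ 5 := by ring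
    _ ≤ 6 ^ 6 * (t : ℝ) / 10 ^ 5 := by
        gcongr
        exact hhex.trans hcount
    _ ≤ t := by
        rw [div_le_iff₀ (by norm_num)]
        nlinarith [Nat.cast_nonneg (α := ℝ) t]
end

section
/- There exist absolute constants C > 0 and c > 0 such that the following holds. Let G be a finite simple graph on n ≥ 2 vertices with m edges, containing t copies of C_6, with maximum degree Δ(G) ≤ m^(2/5), and let ≻ be a linear order on V(G) such that deg(u) > deg(v) implies u ≻ v. Then the number of capped 3-walks in G is at most C·(log₂ n)^c·(m^(8/5) + t). -/
open SimpleGraph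

section SymmetricMatrix

open Matrix

variable {V : Type*} [Fintype V]

lemma sum_sq_mul_self_sq_le (A : Matrix V V ℝ) (hA : A.IsSymm) :
    (∑ x, ∑ y, (A * A) x y ^ 2) ^ 2 ≤
      (∑ x, ∑ y, A x y ^ 2) * ∑ x, ∑ y, (A * A * A) x y ^ 2 := by
  have h : ∑ x, ∑ y, (A * A) x y ^ 2 = ∑ x, ∑ y, A x y * (A * A * A) x y := by
    have h1 := Matrix.sum_hadamard_eq (A * A) (A * A)
    have h2 := Matrix.sum_hadamard_eq A (A * A * A)
    simp only [transpose_mul, hA.eq, hadamard_apply] at h1 h2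
    simp only [sq, h1, mul_assoc] at h2 ⊢
    rw [h2]
  rw [h]
  simp only [← Fintype.sum_prod_type']
  exact Finset.sum_mul_sq_le_sq_mul_sq _ _ _

lemma mulVec_dotProduct_self_le (B : Matrix V V ℝ) (v : V → ℝ) :
    (B *ᵥ v) ⬝ᵥ (B *ᵥ v) ≤ (∑ x, ∑ y, B x y ^ 2) * (v ⬝ᵥ v) := by
  simp only [dotProduct, mulVec, ← sq, Finset.sum_mul]
  gcongr with x
  exact (Finset.sum_mul_sq_le_sq_mul_sq _ _ _).trans_eq (by simp [Finset.sum_mul])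

lemma dotProduct_sq_le (v w : V → ℝ) : (v ⬝ᵥ w) ^ 2 ≤ (v ⬝ᵥ v) * (w ⬝ᵥ w) := by
  simpa only [dotProduct, sq] using Finset.sum_mul_sq_le_sq_mul_sq Finset.univ v w

lemma zero_le_dotProduct_self (v : V → ℝ) : 0 ≤ v ⬝ᵥ v :=
  Finset.sum_nonneg fun i _ => mul_self_nonneg (v i)

lemma mulVec_dotProduct_self_pow_three_le (A : Matrix V V ℝ) (hA : A.IsSymm) (v : V → ℝ) :
    ((A *ᵥ v) ⬝ᵥ (A *ᵥ v)) ^ 3 ≤ (∑ x, ∑ y, (A * A * A) x y ^ 2) * (v ⬝ᵥ v) ^ 3 := by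
  have hsymm : ∀ u w : V → ℝ, (A *ᵥ u) ⬝ᵥ w = u ⬝ᵥ (A *ᵥ w) := fun u w => by
    rw [dotProduct_mulVec, ← mulVec_transpose, hA.eq]
  set m0 := v ⬝ᵥ v
  set m2 := (A *ᵥ v) ⬝ᵥ (A *ᵥ v) with hm2
  set m4 := (A *ᵥ (A *ᵥ v)) ⬝ᵥ (A *ᵥ (A *ᵥ v)) with hm4
  set m6 := (A *ᵥ (A *ᵥ (A *ᵥ v))) ⬝ᵥ (A *ᵥ (A *ᵥ (A *ᵥ v)))
  have h0 : 0 ≤ m0 := zero_le_dotProduct_self _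
  have h2 : 0 ≤ m2 := zero_le_dotProduct_self _
  have h4 : 0 ≤ m4 := zero_le_dotProduct_self _
  have h6 : 0 ≤ m6 := zero_le_dotProduct_self _
  have h24 : m2 ^ 2 ≤ m0 * m4 := by
    rw [hm2, hsymm]
    exact dotProduct_sq_le _ _
  have h46 : m4 ^ 2 ≤ m2 * m6 := by
    rw [hm4, hsymm]
    exact dotProduct_sq_le _ _
  have h6' : m6 ≤ (∑ x, ∑ y, (A * A * A) x y ^ 2) * m0 := by
    have := mulVec_dotProduct_self_le (A * A * A) v
    simpa only [← mulVec_mulVec] using this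
  have h26 : m2 ^ 3 ≤ m0 ^ 2 * m6 := by
    rcases h2.eq_or_lt with h | h
    · rw [← h]
      simpa using by positivity
    · refine le_of_mul_le_mul_left ?_ h
      calc m2 * m2 ^ 3 = (m2 ^ 2) ^ 2 := by ring
        _ ≤ (m0 * m4) ^ 2 := by gcongr
        _ = m0 ^ 2 * m4 ^ 2 := by ring
        _ ≤ m0 ^ 2 * (m2 * m6) := by gcongr
        _ = m2 * (m0 ^ 2 * m6) := by ring
  calc m2 ^ 3 ≤ m0 ^ 2 * m6 := h26
    _ ≤ m0 ^ 2 * ((∑ x, ∑ y, (A * A * A) x y ^ 2) * m0) := by gcongr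
    _ = _ := by ring

lemma dotProduct_mulVec_mulVec_pow_six_le (A : Matrix V V ℝ) (hA : A.IsSymm) (v w : V → ℝ) :
    ((A *ᵥ v) ⬝ᵥ (A *ᵥ w)) ^ 6 ≤
      (∑ x, ∑ y, (A * A * A) x y ^ 2) ^ 2 * ((v ⬝ᵥ v) * (w ⬝ᵥ w)) ^ 3 := by
  have hv := mulVec_dotProduct_self_pow_three_le A hA v
  have hw := mulVec_dotProduct_self_pow_three_le A hA w
  have h0 := zero_le_dotProduct_self (A *ᵥ w)
  have h1 := zero_le_dotProduct_self v
  calc ((A *ᵥ v) ⬝ᵥ (A *ᵥ w)) ^ 6 = (((A *ᵥ v) ⬝ᵥ (A *ᵥ w)) ^ 2) ^ 3 := by ring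
    _ ≤ (((A *ᵥ v) ⬝ᵥ (A *ᵥ v)) * ((A *ᵥ w) ⬝ᵥ (A *ᵥ w))) ^ 3 := by
      gcongr
      exact dotProduct_sq_le _ _
    _ = ((A *ᵥ v) ⬝ᵥ (A *ᵥ v)) ^ 3 * ((A *ᵥ w) ⬝ᵥ (A *ᵥ w)) ^ 3 := by ring
    _ ≤ ((∑ x, ∑ y, (A * A * A) x y ^ 2) * (v ⬝ᵥ v) ^ 3) *
        ((∑ x, ∑ y, (A * A * A) x y ^ 2) * (w ⬝ᵥ w) ^ 3) := by gcongr
    _ = _ := by ring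

end SymmetricMatrix

lemma Fintype.sum_fin_succ_fun {V M : Type*} [Fintype V] [AddCommMonoid M] {n : ℕ}
    (f : (Fin (n + 1) → V) → M) :
    ∑ x, f x = ∑ a, ∑ y : Fin n → V, f (Fin.cons a y) := by
  rw [← (Fin.consEquiv fun _ : Fin (n + 1) => V).sum_comp, Fintype.sum_prod_type]
  rfl

lemma sum_fin_six_fun {V M : Type*} [Fintype V] [AddCommMonoid M] (f : (Fin 6 → V) → M) :
    ∑ x, f x = ∑ a, ∑ b, ∑ c, ∑ d, ∑ e, ∑ g, f ![a, b, c, d, e, g] := by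
  simp only [Fintype.sum_fin_succ_fun, Fintype.sum_unique]
  rfl

section ClosedWalks

variable {V : Type*} (G : SimpleGraph V) [DecidableRel G.Adj]

/-- The indicator that the cyclic sequence `x` of six vertices is a closed walk. -/
def closedWalkWeight (x : Fin 6 → V) : ℝ := ∏ i, G.adjMatrix ℝ (x i) (x (i + 1))

lemma adjMatrix_nonneg (x y : V) : 0 ≤ G.adjMatrix ℝ x y := by
  rw [adjMatrix_apply]
  split_ifs <;> norm_num

lemma closedWalkWeight_nonneg (x : Fin 6 → V) : 0 ≤ closedWalkWeight G x :=
  Finset.prod_nonneg fun _ _ => adjMatrix_nonneg G _ _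

lemma closedWalkWeight_vec (a b c d e f : V) :
    closedWalkWeight G ![a, b, c, d, e, f] =
      G.adjMatrix ℝ a b * (G.adjMatrix ℝ b c * (G.adjMatrix ℝ c d *
        (G.adjMatrix ℝ d e * (G.adjMatrix ℝ e f * G.adjMatrix ℝ f a)))) := by
  rw [closedWalkWeight, Fin.prod_univ_six]
  simp only [mul_assoc]
  rfl

lemma closedWalkWeight_eq_ite (x : Fin 6 → V) :
    closedWalkWeight G x = if ∀ i, G.Adj (x i) (x (i + 1)) then 1 else 0 := by
  simp only [closedWalkWeight, adjMatrix_apply, Finset.prod_ite_zero, Finset.mem_univ,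
    true_imp_iff, Finset.prod_const_one]

lemma adjMatrix_mul_self_swap (x y : V) :
    G.adjMatrix ℝ x y * G.adjMatrix ℝ y x = G.adjMatrix ℝ x y := by
  simp [adjMatrix_apply, G.adj_comm y x]

variable [Fintype V]

lemma sum_adjMatrix_row (x : V) : ∑ y, G.adjMatrix ℝ x y = G.degree x := by
  simpa [Matrix.mulVec, dotProduct] using
    G.adjMatrix_mulVec_const_apply (α := ℝ) (a := 1) (v := x)

lemma sum_adjMatrix_row_sq (x : V) : ∑ y, G.adjMatrix ℝ x y ^ 2 = G.degree x := by
  simp [← sum_adjMatrix_row, adjMatrix_apply]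

lemma sum_degree_eq : ∑ x, (G.degree x : ℝ) = 2 * G.edgeFinset.card := by
  exact_mod_cast G.sum_degrees_eq_twice_card_edges

lemma sum_closedWalkWeight :
    ∑ x, closedWalkWeight G x =
      ∑ x, ∑ y, (G.adjMatrix ℝ * G.adjMatrix ℝ * G.adjMatrix ℝ) x y ^ 2 := by
  have hs : (G.adjMatrix ℝ * G.adjMatrix ℝ * G.adjMatrix ℝ).IsSymm := by
    simp [Matrix.IsSymm, Matrix.transpose_mul, mul_assoc]
  have h : ∀ x y, (G.adjMatrix ℝ * G.adjMatrix ℝ * G.adjMatrix ℝ) x y ^ 2 =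
      (G.adjMatrix ℝ * G.adjMatrix ℝ * G.adjMatrix ℝ) x y *
      (G.adjMatrix ℝ * G.adjMatrix ℝ * G.adjMatrix ℝ) y x := fun x y => by
    rw [sq, hs.apply]
  rw [sum_fin_six_fun]
  refine Finset.sum_congr rfl fun x _ => ?_
  simp only [h]
  rw [← Matrix.mul_apply]
  simp only [mul_assoc]
  simp only [Matrix.mul_apply, Finset.mul_sum, closedWalkWeight_vec]

lemma sum_sq_adjMatrix_sq :
    ∑ x, ∑ y, (G.adjMatrix ℝ * G.adjMatrix ℝ) x y ^ 2 =
      ∑ x, (G.adjMatrix ℝ * (G.adjMatrix ℝ * (G.adjMatrix ℝ * G.adjMatrix ℝ))) x x := by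
  have hs : (G.adjMatrix ℝ * G.adjMatrix ℝ).IsSymm := by
    simp [Matrix.IsSymm, Matrix.transpose_mul]
  rw [← mul_assoc]
  refine Finset.sum_congr rfl fun x _ => ?_
  rw [Matrix.mul_apply]
  exact Finset.sum_congr rfl fun y _ => by rw [sq, hs.apply]

variable [DecidableEq V]

lemma sum_closedWalkWeight_eq_two_le :
    ∑ x, (if x 0 = x 2 then closedWalkWeight G x else 0) ≤
      G.maxDegree * ∑ x, ∑ y, (G.adjMatrix ℝ * G.adjMatrix ℝ) x y ^ 2 := by
  have h : ∑ x, (if x 0 = x 2 then closedWalkWeight G x else 0) =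
      ∑ x, (∑ y, G.adjMatrix ℝ x y) *
        (G.adjMatrix ℝ * (G.adjMatrix ℝ * (G.adjMatrix ℝ * G.adjMatrix ℝ))) x x := by
    simp only [sum_fin_six_fun, closedWalkWeight_vec, Finset.sum_mul]
    refine Finset.sum_congr rfl fun x0 _ => Finset.sum_congr rfl fun x1 _ => ?_
    rw [Finset.sum_eq_single x0]
    · simp only [Matrix.mul_apply, Finset.mul_sum]
      refine Finset.sum_congr rfl fun x3 _ => Finset.sum_congr rfl fun x4 _ =>
        Finset.sum_congr rfl fun x5 _ => ?_
      refine (if_pos rfl).trans ?_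
      rw [← mul_assoc, adjMatrix_mul_self_swap]
    · intro x2 _ hx
      refine Finset.sum_eq_zero fun x3 _ => Finset.sum_eq_zero fun x4 _ =>
        Finset.sum_eq_zero fun x5 _ => if_neg ?_
      exact fun h => hx h.symm
    · simp
  rw [h, sum_sq_adjMatrix_sq, Finset.mul_sum]
  refine Finset.sum_le_sum fun x _ => ?_
  rw [sum_adjMatrix_row]
  gcongr
  · have h0 := adjMatrix_nonneg G
    simp only [Matrix.mul_apply]
    exact Finset.sum_nonneg fun i _ => mul_nonneg (h0 _ _) <|
      Finset.sum_nonneg fun j _ => mul_nonneg (h0 _ _) <|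
      Finset.sum_nonneg fun k _ => mul_nonneg (h0 _ _) (h0 _ _)
  · exact G.degree_le_maxDegree x

lemma sum_closedWalkWeight_eq_three_le :
    ∑ x, (if x 0 = x 3 then closedWalkWeight G x else 0) ≤
      G.maxDegree * ∑ x, ∑ y, (G.adjMatrix ℝ * G.adjMatrix ℝ) x y ^ 2 := by
  have h : ∑ x, (if x 0 = x 3 then closedWalkWeight G x else 0) =
      ∑ x, (G.adjMatrix ℝ * (G.adjMatrix ℝ * G.adjMatrix ℝ)) x x *
        (G.adjMatrix ℝ * (G.adjMatrix ℝ * G.adjMatrix ℝ)) x x := by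
    simp only [sum_fin_six_fun, closedWalkWeight_vec]
    refine Finset.sum_congr rfl fun x0 _ => ?_
    generalize hc : (G.adjMatrix ℝ * (G.adjMatrix ℝ * G.adjMatrix ℝ)) x0 x0 = c
    nth_rewrite 1 [← hc]
    rw [Matrix.mul_apply, Finset.sum_mul]
    refine Finset.sum_congr rfl fun x1 _ => ?_
    rw [Matrix.mul_apply, Finset.mul_sum, Finset.sum_mul]
    refine Finset.sum_congr rfl fun x2 _ => ?_
    rw [Finset.sum_eq_single x0]
    · simp only [← hc, Matrix.mul_apply, Finset.mul_sum]
      refine Finset.sum_congr rfl fun x4 _ => Finset.sum_congr rfl fun x5 _ => ?_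
      refine (if_pos rfl).trans ?_
      ring
    · intro x3 _ hx
      refine Finset.sum_eq_zero fun x4 _ => Finset.sum_eq_zero fun x5 _ =>
        if_neg ?_
      exact fun h => hx h.symm
    · simp
  have hs : (G.adjMatrix ℝ * G.adjMatrix ℝ).IsSymm := by
    simp [Matrix.IsSymm, Matrix.transpose_mul]
  rw [h, Finset.mul_sum]
  refine Finset.sum_le_sum fun x _ => ?_
  rw [← sq, Matrix.mul_apply]
  refine (Finset.sum_mul_sq_le_sq_mul_sq _ _ _).trans ?_
  rw [sum_adjMatrix_row_sq]
  simp only [hs.apply x]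
  gcongr
  exact G.degree_le_maxDegree x

lemma sum_closedWalkWeight_eq_le {i j : Fin 6} (hij : i ≠ j) :
    ∑ x, (if x i = x j then closedWalkWeight G x else 0) ≤
      G.maxDegree * ∑ x, ∑ y, (G.adjMatrix ℝ * G.adjMatrix ℝ) x y ^ 2 := by
  have hshift : ∀ k d : Fin 6, ∑ x, (if x k = x (d + k) then closedWalkWeight G x else 0) =
      ∑ x, (if x 0 = x d then closedWalkWeight G x else 0) := by
    intro k d
    rw [← ((Equiv.addRight k).arrowCongr (Equiv.refl V)).sum_comp]
    refine Finset.sum_congr rfl fun x _ => ?_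
    have hw : closedWalkWeight G ((Equiv.addRight k).arrowCongr (Equiv.refl V) x) =
        closedWalkWeight G x := by
      simp only [closedWalkWeight]
      rw [← Equiv.prod_comp (Equiv.addRight k)]
      refine Finset.prod_congr rfl fun i _ => ?_
      simp [add_right_comm i k 1]
    rw [hw]
    simp
  have hadj : ∀ k, ∑ x, (if x k = x (1 + k) then closedWalkWeight G x else 0) = 0 := by
    intro k
    refine Finset.sum_eq_zero fun x _ => ?_
    split_ifs with h
    · refine Finset.prod_eq_zero (Finset.mem_univ k) ?_
      rw [add_comm k 1, ← h]
      simp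
    · rfl
  have hpos : 0 ≤ G.maxDegree * ∑ x, ∑ y, (G.adjMatrix ℝ * G.adjMatrix ℝ) x y ^ 2 := by positivity
  have hcases : ∀ i j : Fin 6, i ≠ j → j = 1 + i ∨ j = 2 + i ∨ j = 3 + i ∨ i = 2 + j ∨ i = 1 + j := by
    decide
  rcases hcases i j hij with rfl | rfl | rfl | rfl | rfl
  · exact (hadj i).trans_le hpos
  · exact (hshift i 2).trans_le (sum_closedWalkWeight_eq_two_le G)
  · exact (hshift i 3).trans_le (sum_closedWalkWeight_eq_three_le G)
  · refine (Finset.sum_congr rfl fun x _ => if_congr eq_comm rfl rfl).trans_le ?_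
    exact (hshift j 2).trans_le (sum_closedWalkWeight_eq_two_le G)
  · refine (Finset.sum_congr rfl fun x _ => if_congr eq_comm rfl rfl).trans_le ?_
    exact (hadj j).trans_le hpos

lemma card_injective_closed_walks_le :
    ((Finset.univ.filter fun x : Fin 6 → V =>
      Function.Injective x ∧ ∀ i, G.Adj (x i) (x (i + 1))).card) ≤
      6 ^ 6 * countCopiesOfCycle 6 G := by
  classical
  have hcopy : ∀ x : {x : Fin 6 → V // Function.Injective x ∧ ∀ i, G.Adj (x i) (x (i + 1))},
      ∃ H : G.Subgraph, Nonempty (H.coe ≃g cycleGraph 6) ∧ H.verts = Set.range x.1 := by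
    rintro ⟨x, hx, hadj⟩
    let f : Copy (cycleGraph 6) G := ⟨⟨x, by
      intro a b hab
      rw [cycleGraph_adj] at hab
      rcases hab with h | h
      · rw [sub_eq_iff_eq_add'] at h
        exact h ▸ (hadj b).symm
      · rw [sub_eq_iff_eq_add'] at h
        exact h ▸ hadj a⟩, hx⟩
    refine ⟨f.toSubgraph, ⟨f.isoToSubgraph.symm⟩, ?_⟩
    simp [f, Subgraph.map_verts]
  choose F hF hverts using hcopy
  have hfin : {H : G.Subgraph | Nonempty (H.coe ≃g cycleGraph 6)}.Finite := Set.toFinite _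
  rw [← Fintype.card_subtype, countCopiesOfCycle, Set.ncard_eq_toFinset_card _ hfin, mul_comm]
  refine (Finset.card_le_mul_card_image_of_maps_to (f := F) (s := Finset.univ)
    (t := hfin.toFinset) (fun x _ => by simpa using hF x) (6 ^ 6) fun H hH => ?_).trans_eq
      (mul_comm _ _)
  obtain ⟨e⟩ : Nonempty (H.coe ≃g cycleGraph 6) := by simpa using hH
  have hcard : H.verts.toFinset.card = 6 := by
    rw [Set.toFinset_card, Fintype.card_congr e.toEquiv, Fintype.card_fin]
  rw [← Finset.card_map (Function.Embedding.subtype _)]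
  calc _ ≤ (Fintype.piFinset fun _ : Fin 6 => H.verts.toFinset).card := by
        refine Finset.card_le_card fun x hx => ?_
        simp only [Finset.mem_map, Finset.mem_filter, Finset.mem_univ, true_and] at hx
        obtain ⟨y, rfl, rfl⟩ := hx
        simp [hverts]
    _ = 6 ^ 6 := by simp [hcard]

lemma sum_closedWalkWeight_le_add :
    ∑ x, closedWalkWeight G x ≤ 6 ^ 6 * countCopiesOfCycle 6 G +
      30 * (G.maxDegree * ∑ x, ∑ y, (G.adjMatrix ℝ * G.adjMatrix ℝ) x y ^ 2) := by
  classical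
  have hpt : ∀ x : Fin 6 → V, closedWalkWeight G x ≤
      (if Function.Injective x ∧ ∀ i, G.Adj (x i) (x (i + 1)) then 1 else 0) +
      ∑ p ∈ (Finset.univ : Finset (Fin 6)).offDiag,
        if x p.1 = x p.2 then closedWalkWeight G x else 0 := by
    intro x
    have hnn : ∀ p ∈ (Finset.univ : Finset (Fin 6)).offDiag,
        0 ≤ if x p.1 = x p.2 then closedWalkWeight G x else 0 := fun p _ => by
      split_ifs
      exacts [closedWalkWeight_nonneg G x, le_rfl]
    by_cases hx : Function.Injective x
    · have := Finset.sum_nonneg hnn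
      rw [closedWalkWeight_eq_ite] at this ⊢
      simp only [hx, true_and]
      linarith
    · simp only [hx, false_and, if_false, zero_add]
      simp only [Function.Injective, not_forall] at hx
      obtain ⟨i, j, hij, hne⟩ := hx
      refine le_trans ?_ (Finset.single_le_sum hnn (a := (i, j)) (by simpa using hne))
      simp [hij]
  refine (Finset.sum_le_sum fun x _ => hpt x).trans ?_
  rw [Finset.sum_add_distrib, Finset.sum_comm]
  gcongr
  · rw [← Finset.natCast_card_filter]
    exact_mod_cast card_injective_closed_walks_le G
  · refine (Finset.sum_le_card_nsmul _ _ _ fun p hp =>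
      sum_closedWalkWeight_eq_le G (Finset.mem_offDiag.mp hp).2.2).trans_eq ?_
    simp [Finset.offDiag_card]

/-- The number of closed `6`-walks is controlled by the number of hexagons. -/
lemma sum_sq_adjMatrix_cube_le :
    ∑ x, ∑ y, (G.adjMatrix ℝ * G.adjMatrix ℝ * G.adjMatrix ℝ) x y ^ 2 ≤
      100000 * (countCopiesOfCycle 6 G + (G.maxDegree : ℝ) ^ 2 * G.edgeFinset.card) := by
  have h := sum_closedWalkWeight_le_add G
  have h4 := sum_sq_mul_self_sq_le (G.adjMatrix ℝ) (by simp [Matrix.IsSymm])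
  rw [sum_closedWalkWeight] at h
  simp only [sum_adjMatrix_row_sq, sum_degree_eq] at h4
  have h0 : 0 ≤ ∑ x, ∑ y, (G.adjMatrix ℝ * G.adjMatrix ℝ * G.adjMatrix ℝ) x y ^ 2 := by positivity
  generalize ∑ x, ∑ y, (G.adjMatrix ℝ * G.adjMatrix ℝ * G.adjMatrix ℝ) x y ^ 2 = S at *
  generalize ∑ x, ∑ y, (G.adjMatrix ℝ * G.adjMatrix ℝ) x y ^ 2 = Q at *
  have ht : (0 : ℝ) ≤ countCopiesOfCycle 6 G := Nat.cast_nonneg _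
  have hm : (0 : ℝ) ≤ G.edgeFinset.card := Nat.cast_nonneg _
  have hd : (0 : ℝ) ≤ G.maxDegree := Nat.cast_nonneg _
  generalize (countCopiesOfCycle 6 G : ℝ) = t at *
  generalize (G.edgeFinset.card : ℝ) = m at *
  generalize (G.maxDegree : ℝ) = d at *
  have hdm : 0 ≤ d ^ 2 * m := by positivity
  by_contra! hS
  have h1 : S ≤ 60 * (d * Q) := by linarith
  have hSpos : 0 < S := by linarith
  have h2 : S ^ 2 ≤ 7200 * (d ^ 2 * m) * S := by
    calc S ^ 2 ≤ (60 * (d * Q)) ^ 2 := by gcongr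
      _ = 3600 * d ^ 2 * Q ^ 2 := by ring
      _ ≤ 3600 * d ^ 2 * (2 * m * S) := by gcongr
      _ = 7200 * (d ^ 2 * m) * S := by ring
  have h3 : S ≤ 7200 * (d ^ 2 * m) := by
    rw [sq] at h2
    exact le_of_mul_le_mul_right h2 hSpos
  linarith

end ClosedWalks

section CappedWalks

open Matrix

variable {V : Type*} [Fintype V] (G : SimpleGraph V) [DecidableRel G.Adj]

/-- The indicator of the vertices of positive degree in `[2 ^ j, 2 ^ (j + 1))`. -/
def degreeClass (j : ℕ) (x : V) : ℝ :=
  if G.degree x ≠ 0 ∧ Nat.log 2 (G.degree x) = j then 1 else 0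

/-- The degree function, restricted to the vertices of degree less than `2 ^ (j + 1)`. -/
def truncatedDegree (j : ℕ) (x : V) : ℝ :=
  if Nat.log 2 (G.degree x) ≤ j then (G.degree x : ℝ) else 0

/-- An upper bound for the number of capped `3`-walks starting at a vertex of degree in
`[2 ^ j, 2 ^ (j + 1))`. -/
def degreeClassWalks (j : ℕ) : ℝ :=
  (G.adjMatrix ℝ *ᵥ degreeClass G j) ⬝ᵥ (G.adjMatrix ℝ *ᵥ truncatedDegree G j)

lemma degreeClass_dotProduct_self_le (j : ℕ) :
    (degreeClass G j ⬝ᵥ degreeClass G j) * 2 ^ j ≤ 2 * G.edgeFinset.card := by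
  rw [← sum_degree_eq, dotProduct, Finset.sum_mul]
  refine Finset.sum_le_sum fun x _ => ?_
  unfold degreeClass
  split_ifs with h
  · simp only [one_mul]
    exact_mod_cast h.2 ▸ Nat.pow_log_le_self 2 h.1
  · simp

lemma truncatedDegree_dotProduct_self_le (j : ℕ) :
    truncatedDegree G j ⬝ᵥ truncatedDegree G j ≤ 2 ^ (j + 1) * (2 * G.edgeFinset.card) := by
  rw [← sum_degree_eq, dotProduct, Finset.mul_sum]
  refine Finset.sum_le_sum fun x _ => ?_
  unfold truncatedDegree
  split_ifs with h
  · gcongr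
    have := Nat.lt_pow_succ_log_self (b := 2) one_lt_two (G.degree x)
    have h2 : 2 ^ (Nat.log 2 (G.degree x)).succ ≤ 2 ^ (j + 1) := by gcongr <;> omega
    exact_mod_cast this.le.trans h2
  · simp only [mul_zero]
    positivity

lemma cappedWalkCount_three_eq (r : V → V → Prop) [DecidableRel r] :
    (cappedWalkCount G r 3 : ℝ) = ∑ a, ∑ b, ∑ c, ∑ d,
      if (G.Adj a b ∧ G.Adj b c ∧ G.Adj c d) ∧ r a b ∧ r a c ∧ r a d then 1 else 0 := by
  classical
  rw [cappedWalkCount, Set.ncard_eq_toFinset_card', Set.toFinset_ofPred, Finset.natCast_card_filter]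
  simp only [Fintype.sum_fin_succ_fun, Fintype.sum_unique, Fin.forall_fin_succ]
  simp only [IsEmpty.forall_iff, and_true]
  rfl

lemma cappedWalkCount_three_le_maxDegree (r : V → V → Prop) :
    (cappedWalkCount G r 3 : ℝ) ≤ 2 * ((G.maxDegree : ℝ) ^ 2 * G.edgeFinset.card) := by
  classical
  have hdeg : ∀ x, (G.degree x : ℝ) ≤ G.maxDegree := fun x => by
    exact_mod_cast G.degree_le_maxDegree x
  have hA := adjMatrix_nonneg G
  calc (cappedWalkCount G r 3 : ℝ)
      ≤ ∑ a, ∑ b, ∑ c, ∑ d, G.adjMatrix ℝ a b * (G.adjMatrix ℝ b c * G.adjMatrix ℝ c d) := by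
        rw [cappedWalkCount_three_eq]
        gcongr with a _ b _ c _ d
        split_ifs with h
        · simp [adjMatrix_apply, h.1]
        · exact mul_nonneg (hA _ _) (mul_nonneg (hA _ _) (hA _ _))
    _ = ∑ a, ∑ b, G.adjMatrix ℝ a b * ∑ c, G.adjMatrix ℝ b c * ∑ d, G.adjMatrix ℝ c d := by
        simp only [Finset.mul_sum]
    _ ≤ ∑ a, ∑ b, G.adjMatrix ℝ a b * ∑ c, G.adjMatrix ℝ b c * G.maxDegree := by
        gcongr with a _ b _ c
        · exact hA a b
        · exact hA b c
        · exact (sum_adjMatrix_row G c).trans_le (hdeg c)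
    _ ≤ ∑ a, ∑ b, G.adjMatrix ℝ a b * (G.maxDegree * G.maxDegree) := by
        gcongr with a _ b
        · exact hA a b
        · rw [← Finset.sum_mul, sum_adjMatrix_row]
          gcongr
          exact G.degree_le_maxDegree b
    _ = 2 * ((G.maxDegree : ℝ) ^ 2 * G.edgeFinset.card) := by
        simp only [← Finset.sum_mul, sum_adjMatrix_row, sum_degree_eq]
        ring

lemma cappedWalkCount_three_le_sum (r : V → V → Prop) [IsStrictTotalOrder V r]
    (hr : ∀ u v : V, G.degree u > G.degree v → r u v) :
    (cappedWalkCount G r 3 : ℝ) ≤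
      ∑ j ∈ Finset.range (Nat.log 2 (Fintype.card V) + 1), degreeClassWalks G j := by
  classical
  have hA := adjMatrix_nonneg G
  have hexpand : ∀ j, degreeClassWalks G j =
      ∑ a, ∑ b, ∑ c, ∑ d, degreeClass G j a * G.adjMatrix ℝ a b * (G.adjMatrix ℝ b c *
        ((if Nat.log 2 (G.degree c) ≤ j then 1 else 0) * G.adjMatrix ℝ c d)) := by
    intro j
    rw [degreeClassWalks, Finset.sum_comm]
    refine Finset.sum_congr rfl fun b _ => ?_
    simp only [mulVec, dotProduct]
    rw [Finset.sum_mul]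
    refine Finset.sum_congr rfl fun a _ => ?_
    rw [Finset.mul_sum]
    refine Finset.sum_congr rfl fun c _ => ?_
    rw [← Finset.mul_sum, ← Finset.mul_sum, ← Finset.mul_sum, sum_adjMatrix_row, truncatedDegree,
      (G.isSymm_adjMatrix (α := ℝ)).apply a b]
    split_ifs <;> ring
  simp only [hexpand]
  rw [Finset.sum_comm, cappedWalkCount_three_eq]
  gcongr with a _
  refine le_of_le_of_eq ?_ Finset.sum_comm
  gcongr with b _
  refine le_of_le_of_eq ?_ Finset.sum_comm
  gcongr with c _
  refine le_of_le_of_eq ?_ Finset.sum_comm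
  gcongr with d _
  have hnn : ∀ j ∈ Finset.range (Nat.log 2 (Fintype.card V) + 1),
      0 ≤ degreeClass G j a * G.adjMatrix ℝ a b * (G.adjMatrix ℝ b c *
        ((if Nat.log 2 (G.degree c) ≤ j then 1 else 0) * G.adjMatrix ℝ c d)) := fun j _ => by
    refine mul_nonneg (mul_nonneg ?_ (hA _ _)) (mul_nonneg (hA _ _) (mul_nonneg ?_ (hA _ _)))
    · unfold degreeClass
      split_ifs <;> norm_num
    · split_ifs <;> norm_num
  split_ifs with h
  · obtain ⟨⟨hab, hbc, hcd⟩, -, hac, -⟩ := h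
    have hle : G.degree c ≤ G.degree a := by
      by_contra! hlt
      exact asymm_of r hac (hr c a hlt)
    have ha : G.degree a ≠ 0 := by
      have := (G.degree_pos_iff_exists_adj a).mpr ⟨b, hab⟩
      omega
    refine le_trans ?_ (Finset.single_le_sum hnn (a := Nat.log 2 (G.degree a)) ?_)
    · simp [degreeClass, adjMatrix_apply, hab, hbc, hcd, ha, Nat.log_mono_right hle]
    · rw [Finset.mem_range, Nat.lt_succ_iff]
      exact Nat.log_mono_right (G.degree_lt_card_verts a).le
  · exact Finset.sum_nonneg hnn

variable [DecidableEq V]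

lemma degreeClassWalks_pow_six_le (j : ℕ) :
    degreeClassWalks G j ^ 6 ≤
      (100000 * (countCopiesOfCycle 6 G + (G.maxDegree : ℝ) ^ 2 * G.edgeFinset.card)) ^ 2 *
        (8 * (G.edgeFinset.card : ℝ) ^ 2) ^ 3 := by
  refine (dotProduct_mulVec_mulVec_pow_six_le _ G.isSymm_adjMatrix _ _).trans ?_
  have h1 := degreeClass_dotProduct_self_le G j
  have h2 := truncatedDegree_dotProduct_self_le G j
  have h3 := zero_le_dotProduct_self (degreeClass G j)
  have h4 := zero_le_dotProduct_self (truncatedDegree G j)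
  have h5 : (degreeClass G j ⬝ᵥ degreeClass G j) * (truncatedDegree G j ⬝ᵥ truncatedDegree G j) ≤
      8 * (G.edgeFinset.card : ℝ) ^ 2 := by
    calc _ ≤ (degreeClass G j ⬝ᵥ degreeClass G j) * (2 ^ (j + 1) * (2 * G.edgeFinset.card)) := by
          gcongr
      _ = (degreeClass G j ⬝ᵥ degreeClass G j) * 2 ^ j * (4 * G.edgeFinset.card) := by ring
      _ ≤ 2 * G.edgeFinset.card * (4 * G.edgeFinset.card) := by gcongr
      _ = _ := by ring
  gcongr
  exact sum_sq_adjMatrix_cube_le G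

end CappedWalks

/-- Bound on capped `3`-walks: if `Δ(G) ≤ m^(2/5)` then the number of capped
`3`-walks in `G` is at most `C·(log₂ n)^c·(m^(8/5) + t)` where `t` is the number
of hexagons in `G`. -/
theorem capped_three_walks_bound :
    ∃ C c : ℝ, 0 < C ∧ 0 < c ∧
      ∀ (V : Type) [Fintype V] [DecidableEq V] (G : SimpleGraph V) [DecidableRel G.Adj]
        (r : V → V → Prop), IsStrictTotalOrder V r →
        (∀ u v : V, G.degree u > G.degree v → r u v) →
        2 ≤ Fintype.card V →
        (G.maxDegree : ℝ) ≤ (G.edgeFinset.card : ℝ) ^ ((2 : ℝ) / 5) →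
        (cappedWalkCount G r 3 : ℝ) ≤
          C * (Real.logb 2 (Fintype.card V)) ^ c *
            ((G.edgeFinset.card : ℝ) ^ ((8 : ℝ) / 5) + (countCopiesOfCycle 6 G : ℝ)) := by
  refine ⟨2000, 1, by norm_num, by norm_num, ?_⟩
  intro V _ _ G _ r hr hdeg hn hmax
  have hlog1 : 1 ≤ Real.logb 2 (Fintype.card V) := by
    rw [Real.le_logb_iff_rpow_le one_lt_two (by positivity), Real.rpow_one]
    exact_mod_cast hn
  have hlog2 : (Nat.log 2 (Fintype.card V) : ℝ) ≤ Real.logb 2 (Fintype.card V) :=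
    Real.natLog_le_logb _ _
  have htriv := cappedWalkCount_three_le_maxDegree G r
  have hsum := cappedWalkCount_three_le_sum G r hdeg
  have hsix := degreeClassWalks_pow_six_le G
  rw [Real.rpow_one]
  have ht : (0 : ℝ) ≤ countCopiesOfCycle 6 G := Nat.cast_nonneg _
  have hm : (0 : ℝ) ≤ G.edgeFinset.card := Nat.cast_nonneg _
  generalize (countCopiesOfCycle 6 G : ℝ) = t at *
  generalize (G.edgeFinset.card : ℝ) = m at *
  have hpow : 0 ≤ m ^ ((8 : ℝ) / 5) := by positivity
  rcases le_total ((G.maxDegree : ℝ) ^ 2 * m) t with h | h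
  · calc (cappedWalkCount G r 3 : ℝ) ≤ 2000 * 1 * (0 + t) := by linarith
      _ ≤ _ := by gcongr
  · have hdm : (G.maxDegree : ℝ) ^ 2 * m ≤ m ^ ((9 : ℝ) / 5) := by
      calc (G.maxDegree : ℝ) ^ 2 * m ≤ (m ^ ((2 : ℝ) / 5)) ^ 2 * m := by gcongr
        _ = m ^ ((9 : ℝ) / 5) := by
          rw [← Real.rpow_mul_natCast hm, ← Real.rpow_add_one' hm (by norm_num)]
          norm_num
    have hj : ∀ j, degreeClassWalks G j ≤
        1000 * m ^ ((8 : ℝ) / 5) := by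
      intro j
      refine le_of_pow_le_pow_left₀ (n := 6) (by norm_num) (by positivity) ((hsix j).trans ?_)
      have h98 : (m ^ ((9 : ℝ) / 5)) ^ 2 * m ^ 6 = (m ^ ((8 : ℝ) / 5)) ^ 6 := by
        rw [← Real.rpow_mul_natCast hm, ← Real.rpow_mul_natCast hm,
          ← Real.rpow_add_natCast' hm (by norm_num)]
        norm_num
      calc (100000 * (t + (G.maxDegree : ℝ) ^ 2 * m)) ^ 2 * (8 * m ^ 2) ^ 3
          ≤ (100000 * (m ^ ((9 : ℝ) / 5) + m ^ ((9 : ℝ) / 5))) ^ 2 * (8 * m ^ 2) ^ 3 := by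
            gcongr
            exact h.trans hdm
        _ = 20480000000000 * ((m ^ ((9 : ℝ) / 5)) ^ 2 * m ^ 6) := by ring
        _ ≤ 1000000000000000000 * ((m ^ ((9 : ℝ) / 5)) ^ 2 * m ^ 6) := by
            gcongr
            norm_num
        _ = (1000 * m ^ ((8 : ℝ) / 5)) ^ 6 := by
            rw [h98]
            ring
    calc (cappedWalkCount G r 3 : ℝ)
        ≤ ∑ _j ∈ Finset.range (Nat.log 2 (Fintype.card V) + 1), 1000 * m ^ ((8 : ℝ) / 5) :=
          hsum.trans (Finset.sum_le_sum fun j _ => hj j)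
      _ = (Nat.log 2 (Fintype.card V) + 1) * (1000 * m ^ ((8 : ℝ) / 5)) := by simp
      _ ≤ (Real.logb 2 (Fintype.card V) + Real.logb 2 (Fintype.card V)) *
          (1000 * (m ^ ((8 : ℝ) / 5) + t)) := by
          gcongr
          linarith
      _ = _ := by ring
end
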